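/- arXiv:2309.13598 — 10 statements merged into one kernel-verified Lean document; each statement's English description precedes it below -/
import Mathlib

section
/- For every y ∈ ℝ, the function p_Y is differentiable at y and its logarithmic derivative satisfies Tweedie's identity: p_Y'(y) = p_Y(y) · (μ₁(y) − y) / σ². Equivalently, d/dy log p_Y(y) = (μ₁(y) − y) / σ². -/
open MeasureTheory Real

/-- Differentiation under the integral sign for the convolution of an integrable function with a
bounded differentiable kernel whose derivative is bounded. -/
theorem hasDerivAt_integral_kernel_mul {φ φ' p : ℝ → ℝ} {B K : ℝ}
    (hφ : ∀ t, HasDerivAt φ (φ' t) t) (hφ_bdd : ∀ t, ‖φ t‖ ≤ B)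
    (hφ' : Measurable φ') (hφ'_bdd : ∀ t, ‖φ' t‖ ≤ K) (hp : Integrable p) (y : ℝ) :
    Integrable (fun x ↦ φ (y - x) * p x) ∧ Integrable (fun x ↦ φ' (y - x) * p x) ∧
      HasDerivAt (fun z ↦ ∫ x, φ (z - x) * p x) (∫ x, φ' (y - x) * p x) y := by
  have hφ_cont : Continuous φ := continuous_iff_continuousAt.2 fun t ↦ (hφ t).continuousAt
  have h_meas (z : ℝ) : AEStronglyMeasurable (fun x ↦ φ (z - x)) volume := by fun_prop
  have h_int : Integrable (fun x ↦ φ (y - x) * p x) :=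
    hp.bdd_mul (h_meas y) (.of_forall fun x ↦ hφ_bdd (y - x))
  refine ⟨h_int, hasDerivAt_integral_of_dominated_loc_of_deriv_le (s := Set.univ)
    (bound := fun x ↦ K * ‖p x‖) (F' := fun z x ↦ φ' (z - x) * p x) Filter.univ_mem
    (.of_forall fun z ↦ (h_meas z).mul hp.1) h_int ?_ ?_ (hp.norm.const_mul K) ?_⟩
  · exact (hφ'.comp (measurable_const.sub measurable_id)).aestronglyMeasurable.mul hp.1
  · refine .of_forall fun x z _ ↦ ?_
    rw [norm_mul]
    exact mul_le_mul_of_nonneg_right (hφ'_bdd _) (norm_nonneg _)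
  · exact .of_forall fun x z _ ↦ ((hφ (z - x)).comp_sub_const z x).mul_const (p x)

theorem abs_mul_exp_neg_sq_div_le {σ : ℝ} (hσ : 0 < σ) (t : ℝ) :
    |t| * exp (-t ^ 2 / (2 * σ ^ 2)) ≤ σ := by
  have h_exp : t ^ 2 / (2 * σ ^ 2) + 1 ≤ exp (t ^ 2 / (2 * σ ^ 2)) := add_one_le_exp _
  have h_abs : |t| ≤ σ * (t ^ 2 / (2 * σ ^ 2) + 1) := by
    have : σ * (t ^ 2 / (2 * σ ^ 2) + 1) - |t| = ((|t| - σ) ^ 2 + σ ^ 2) / (2 * σ) := by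
      rw [← sq_abs t]
      field_simp
      ring
    have : 0 ≤ ((|t| - σ) ^ 2 + σ ^ 2) / (2 * σ) := by positivity
    linarith
  rw [neg_div, exp_neg, ← div_eq_mul_inv, div_le_iff₀ (exp_pos _)]
  exact h_abs.trans (mul_le_mul_of_nonneg_left h_exp hσ.le)

/-- **Tweedie's identity (univariate).** For every `y`, the noisy-observation density `pY`
is differentiable at `y` with `pY' y = pY y * (μ₁ y - y) / σ²`. -/
theorem tweedie_univariate
    (σ : ℝ) (hσ : 0 < σ)
    (p : ℝ → ℝ) (hp_meas : Measurable p) (hp_nonneg : ∀ x, 0 ≤ p x)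
    (hp_bdd : ∃ C, ∀ x, p x ≤ C) (hp_supp : HasCompactSupport p)
    (hp_int : ∫ x, p x = 1)
    (φ : ℝ → ℝ)
    (hφ : ∀ t, φ t = (2 * π * σ ^ 2) ^ (-(1 : ℝ) / 2) * Real.exp (-t ^ 2 / (2 * σ ^ 2)))
    (pY : ℝ → ℝ) (hpY : ∀ y, pY y = ∫ x, φ (y - x) * p x)
    (hpY_pos : ∀ y, 0 < pY y)
    (μ₁ : ℝ → ℝ) (hμ₁ : ∀ y, μ₁ y = (∫ x, x * φ (y - x) * p x) / pY y)
    (y : ℝ) :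
    HasDerivAt pY (pY y * (μ₁ y - y) / σ ^ 2) y := by
  set c : ℝ := (2 * π * σ ^ 2) ^ (-(1 : ℝ) / 2)
  have hc : 0 ≤ c := by positivity
  have hφ_deriv (t : ℝ) : HasDerivAt φ (-t / σ ^ 2 * φ t) t := by
    rw [funext hφ]
    have h := (((hasDerivAt_pow 2 t).neg.div_const (2 * σ ^ 2)).exp).const_mul c
    refine h.congr_deriv ?_
    simp only [Pi.neg_apply]
    field_simp
    ring
  have hφ_bdd (t : ℝ) : ‖φ t‖ ≤ c := by
    rw [hφ, norm_of_nonneg (by positivity)]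
    refine mul_le_of_le_one_right hc (exp_le_one_iff.2 ?_)
    rw [neg_div]
    exact neg_nonpos.2 (by positivity)
  have hφ'_bdd (t : ℝ) : ‖-t / σ ^ 2 * φ t‖ ≤ c * σ / σ ^ 2 := by
    have h_norm : ‖-t / σ ^ 2 * φ t‖ = c * (|t| * exp (-t ^ 2 / (2 * σ ^ 2))) / σ ^ 2 := by
      rw [hφ, norm_mul, norm_div, norm_neg, norm_of_nonneg (sq_nonneg σ), norm_eq_abs t,
        norm_of_nonneg (mul_nonneg hc (exp_pos _).le)]
      ring
    rw [h_norm]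
    gcongr
    exact abs_mul_exp_neg_sq_div_le hσ t
  have hφ_cont : Continuous φ := continuous_iff_continuousAt.2 fun t ↦ (hφ_deriv t).continuousAt
  obtain ⟨h_int, h_int', h_deriv⟩ := hasDerivAt_integral_kernel_mul hφ_deriv hφ_bdd
    (by fun_prop) hφ'_bdd (integrable_of_integral_eq_one hp_int) y
  have h_first : ∫ x, x * φ (y - x) * p x =
      σ ^ 2 * (∫ x, -(y - x) / σ ^ 2 * φ (y - x) * p x) + y * pY y := by
    rw [hpY, ← integral_const_mul, ← integral_const_mul,
      ← integral_add (h_int'.const_mul _) (h_int.const_mul _)]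
    congr 1 with x
    field_simp
    ring
  rw [← funext hpY] at h_deriv
  refine h_deriv.congr_deriv ?_
  rw [hμ₁, h_first]
  have := (hpY_pos y).ne'
  field_simp
  ring
end

section
/- For every y ∈ ℝ, the posterior mean μ₁ is differentiable at y and the second posterior central moment satisfies μ₂(y) = σ² · μ₁'(y). -/
open MeasureTheory Real

/-- A continuous function times a compactly supported integrable function is integrable. -/
theorem integrable_continuous_mul_of_hasCompactSupport {h g : ℝ → ℝ} (hh : Continuous h)
    (hg : Integrable g) (hgs : HasCompactSupport g) : Integrable fun x ↦ h x * g x := by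
  have hs : Function.support (fun x ↦ h x * g x) ⊆ tsupport g :=
    (Function.support_mul_subset_right h g).trans (subset_tsupport g)
  exact (integrableOn_iff_integrable_of_support_subset hs).1
    (hg.integrableOn.continuousOn_mul hh.continuousOn hgs)

/-- Differentiation under the integral sign for the convolution of a `C¹` kernel with a compactly
supported integrable function. -/
theorem hasDerivAt_integral_sub_mul_of_hasCompactSupport {K K' g : ℝ → ℝ}
    (hK : ∀ t, HasDerivAt K (K' t) t) (hK' : Continuous K')
    (hg : Integrable g) (hgs : HasCompactSupport g) (y : ℝ) :
    HasDerivAt (fun z ↦ ∫ x, K (z - x) * g x) (∫ x, K' (y - x) * g x) y := by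
  have hKc : Continuous K := continuous_iff_continuousAt.2 fun t ↦ (hK t).continuousAt
  have hint {h : ℝ → ℝ} (hh : Continuous h) (z : ℝ) : Integrable fun x ↦ h (z - x) * g x :=
    integrable_continuous_mul_of_hasCompactSupport (hh.comp (continuous_const.sub continuous_id))
      hg hgs
  obtain ⟨C, hC⟩ := ((isCompact_closedBall y 1).prod hgs).exists_bound_of_continuousOn
    (f := fun q : ℝ × ℝ ↦ K' (q.1 - q.2)) (by fun_prop)
  refine (hasDerivAt_integral_of_dominated_loc_of_deriv_le (bound := fun x ↦ C * ‖g x‖)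
    (F := fun z x ↦ K (z - x) * g x) (F' := fun z x ↦ K' (z - x) * g x)
    (Metric.closedBall_mem_nhds y one_pos) (.of_forall fun z ↦ (hint hKc z).aestronglyMeasurable)
    (hint hKc y) (hint hK' y).aestronglyMeasurable (.of_forall fun x z hz ↦ ?_)
    (hg.norm.const_mul C) (.of_forall fun x z _ ↦ ?_)).2
  · rw [norm_mul]
    by_cases hx : x ∈ tsupport g
    · exact mul_le_mul_of_nonneg_right (hC (z, x) ⟨hz, hx⟩) (norm_nonneg _)
    · simp [image_eq_zero_of_notMem_tsupport hx]
  · exact ((hK (z - x)).comp_sub_const z x).mul_const (g x)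

/-- For every `y`, the posterior mean `μ₁` is differentiable at `y` and the second
posterior central moment satisfies `μ₂ y = σ² * μ₁' y`. -/
theorem second_central_moment_eq_deriv_posterior_mean
    (σ : ℝ) (hσ : 0 < σ)
    (p : ℝ → ℝ) (hp_meas : Measurable p) (hp_nonneg : ∀ x, 0 ≤ p x)
    (hp_bdd : ∃ C, ∀ x, p x ≤ C) (hp_supp : HasCompactSupport p)
    (hp_int : ∫ x, p x = 1)
    (φ : ℝ → ℝ)
    (hφ : ∀ t, φ t = (2 * π * σ ^ 2) ^ (-(1 : ℝ) / 2) * Real.exp (-t ^ 2 / (2 * σ ^ 2)))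
    (pY : ℝ → ℝ) (hpY : ∀ y, pY y = ∫ x, φ (y - x) * p x)
    (hpY_pos : ∀ y, 0 < pY y)
    (μ₁ : ℝ → ℝ) (hμ₁ : ∀ y, μ₁ y = (∫ x, x * φ (y - x) * p x) / pY y)
    (μ : ℕ → ℝ → ℝ)
    (hμ : ∀ k, 2 ≤ k → ∀ y, μ k y = (∫ x, (x - μ₁ y) ^ k * φ (y - x) * p x) / pY y)
    (y : ℝ) :
    DifferentiableAt ℝ μ₁ y ∧ μ 2 y = σ ^ 2 * deriv μ₁ y := by
  have hp : Integrable p := by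
    by_contra h
    simp [integral_undef h] at hp_int
  have hφd (t : ℝ) : HasDerivAt φ (-t / σ ^ 2 * φ t) t := by
    rw [funext hφ]
    have h := ((((hasDerivAt_id t).pow 2).neg.div_const (2 * σ ^ 2)).exp).const_mul
      ((2 * π * σ ^ 2) ^ (-(1 : ℝ) / 2))
    refine h.congr_deriv ?_
    simp only [Pi.pow_apply, Pi.neg_apply, id]
    field_simp
    norm_num
  have hφc : Continuous φ := continuous_iff_continuousAt.2 fun t ↦ (hφd t).continuousAt
  have hφ'c : Continuous fun t ↦ -t / σ ^ 2 * φ t := by fun_prop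
  have hI {h : ℝ → ℝ} (hh : Continuous h) : Integrable fun x ↦ h x * p x :=
    integrable_continuous_mul_of_hasCompactSupport hh hp hp_supp
  have hI0 : Integrable fun x ↦ φ (y - x) * p x := hI (by fun_prop)
  have hI1 : Integrable fun x ↦ x * φ (y - x) * p x := hI (by fun_prop)
  have hI2 : Integrable fun x ↦ x ^ 2 * φ (y - x) * p x := hI (by fun_prop)
  set N : ℝ → ℝ := fun z ↦ ∫ x, x * φ (z - x) * p x with hN
  set M : ℝ := ∫ x, x ^ 2 * φ (y - x) * p x with hM
  have hpYd : HasDerivAt pY ((N y - y * pY y) / σ ^ 2) y := by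
    convert hasDerivAt_integral_sub_mul_of_hasCompactSupport hφd hφ'c hp hp_supp y using 1
    · exact funext hpY
    · rw [hpY y, hN, ← integral_const_mul, ← integral_sub hI1 (hI0.const_mul y),
        ← integral_div]
      congr 1 with x
      ring
  have hNd : HasDerivAt N ((M - y * N y) / σ ^ 2) y := by
    convert hasDerivAt_integral_sub_mul_of_hasCompactSupport (g := fun x ↦ x * p x) hφd hφ'c
      (hI continuous_id) hp_supp.mul_left y using 1
    · funext z
      exact integral_congr_ae (.of_forall fun x ↦ by ring)
    · rw [hM, hN, ← integral_const_mul, ← integral_sub hI2 (hI1.const_mul y), ← integral_div]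
      congr 1 with x
      ring
  have hpos : pY y ≠ 0 := (hpY_pos y).ne'
  have hd := hNd.div hpYd hpos
  have hμ₁' : μ₁ = N / pY := funext hμ₁
  rw [← hμ₁'] at hd
  refine ⟨hd.differentiableAt, ?_⟩
  have hc : ∫ x, (x - μ₁ y) ^ 2 * φ (y - x) * p x = M - 2 * μ₁ y * N y + μ₁ y ^ 2 * pY y := by
    rw [hpY y, hM, hN, ← integral_const_mul, ← integral_const_mul,
      ← integral_sub hI2 (hI1.const_mul _),
      ← integral_add (by exact hI2.sub (hI1.const_mul _)) (hI0.const_mul _)]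
    congr 1 with x
    ring
  have hμ₁y : μ₁ y = N y / pY y := hμ₁ y
  rw [hd.deriv, hμ 2 le_rfl, hc, hμ₁y]
  field_simp
  ring
end

section
/- For every y ∈ ℝ, the posterior mean μ₁ is differentiable at y, and its derivative satisfies μ₁'(y) = (1/σ²) · (m₂(y) − μ₁(y)²), where m₂(y) = (∫ x² φ_σ(y−x) p(x) dx) / p_Y(y) is the second non-central posterior moment. -/
open MeasureTheory Real

/-- The product of a continuous function and an integrable function with compact support is
integrable. -/
lemma integrable_continuous_mul_of_hasCompactSupport_s2 {f q : ℝ → ℝ} (hf : Continuous f)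
    (hq : Integrable q) (hq_supp : HasCompactSupport q) : Integrable (fun x ↦ f x * q x) := by
  have hsub : Function.support (fun x ↦ f x * q x) ⊆ tsupport q := fun x hx ↦
    subset_tsupport q (right_ne_zero_of_mul hx)
  rw [← integrableOn_iff_integrable_of_support_subset hsub]
  exact hq.integrableOn.continuousOn_mul hf.continuousOn hq_supp

/-- Differentiation under the integral sign for the convolution of an unnormalized Gaussian with
a function having an integrable first moment. -/
lemma hasDerivAt_integral_gaussian_mul {σ : ℝ} (hσ : 0 < σ) {q : ℝ → ℝ} (hq : Integrable q)
    (hxq : Integrable (fun x ↦ x * q x)) (y : ℝ) :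
    HasDerivAt (fun y ↦ ∫ x, rexp (-(y - x) ^ 2 / (2 * σ ^ 2)) * q x)
      ((1 / σ ^ 2) * ((∫ x, rexp (-(y - x) ^ 2 / (2 * σ ^ 2)) * (x * q x)) -
        y * ∫ x, rexp (-(y - x) ^ 2 / (2 * σ ^ 2)) * q x)) y := by
  have hexp : ∀ z x : ℝ, ‖rexp (-(z - x) ^ 2 / (2 * σ ^ 2))‖ ≤ 1 := fun z x ↦ by
    rw [norm_eq_abs, abs_of_pos (exp_pos _), exp_le_one_iff]
    exact div_nonpos_of_nonpos_of_nonneg (by nlinarith [sq_nonneg (z - x)]) (by positivity)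
  have hint : ∀ {r : ℝ → ℝ}, Integrable r → ∀ z : ℝ,
      Integrable (fun x ↦ rexp (-(z - x) ^ 2 / (2 * σ ^ 2)) * r x) := fun hr z ↦
    hr.bdd_mul (Continuous.aestronglyMeasurable (by fun_prop)) (.of_forall (hexp z))
  have key := hasDerivAt_integral_of_dominated_loc_of_deriv_le (μ := volume) (x₀ := y)
    (s := Metric.ball y 1)
    (F := fun z x ↦ rexp (-(z - x) ^ 2 / (2 * σ ^ 2)) * q x)
    (F' := fun z x ↦ (1 / σ ^ 2) * (rexp (-(z - x) ^ 2 / (2 * σ ^ 2)) * (x * q x) -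
      z * (rexp (-(z - x) ^ 2 / (2 * σ ^ 2)) * q x)))
    (bound := fun x ↦ (1 / σ ^ 2) * (‖x * q x‖ + (|y| + 1) * ‖q x‖))
    (Metric.ball_mem_nhds y one_pos)
    (.of_forall fun z ↦ (hint hq z).aestronglyMeasurable) (hint hq y)
    (((hint hxq y).sub ((hint hq y).const_mul y)).const_mul _).aestronglyMeasurable
    (.of_forall fun x z hz ↦ ?_) ((hxq.norm.add (hq.norm.const_mul _)).const_mul _)
    (.of_forall fun x z _ ↦ ?_)
  · have h := key.2
    rwa [integral_const_mul, integral_sub (hint hxq y) ((hint hq y).const_mul y),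
      integral_const_mul] at h
  · have hz' : |z| ≤ |y| + 1 := by
      have h1 : |z - y| < 1 := by simpa [Real.dist_eq] using hz
      have h2 := abs_sub_abs_le_abs_sub z y
      linarith
    rw [norm_mul, norm_of_nonneg (by positivity : (0 : ℝ) ≤ 1 / σ ^ 2)]
    refine mul_le_mul_of_nonneg_left ((norm_sub_le _ _).trans (add_le_add ?_ ?_)) (by positivity)
    · rw [norm_mul]
      exact mul_le_of_le_one_left (norm_nonneg _) (hexp z x)
    · rw [norm_mul, norm_mul _ (q x)]
      exact mul_le_mul hz' (mul_le_of_le_one_left (norm_nonneg _) (hexp z x)) (by positivity)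
        (by positivity)
  · have h := (((((hasDerivAt_id z).sub_const x).pow 2).neg.div_const (2 * σ ^ 2)).exp).mul_const
      (q x)
    refine h.congr_deriv ?_
    simp
    field_simp
    ring

/-- For every `y`, the posterior mean `μ₁` is differentiable at `y` and
`μ₁' y = (1/σ²) * (m₂ y - (μ₁ y)²)`, where `m₂` is the second non-central posterior moment. -/
theorem deriv_posterior_mean_eq_variance
    (σ : ℝ) (hσ : 0 < σ)
    (p : ℝ → ℝ) (hp_meas : Measurable p) (hp_nonneg : ∀ x, 0 ≤ p x)
    (hp_bdd : ∃ C, ∀ x, p x ≤ C) (hp_supp : HasCompactSupport p)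
    (hp_int : ∫ x, p x = 1)
    (φ : ℝ → ℝ)
    (hφ : ∀ t, φ t = (2 * π * σ ^ 2) ^ (-(1 : ℝ) / 2) * Real.exp (-t ^ 2 / (2 * σ ^ 2)))
    (pY : ℝ → ℝ) (hpY : ∀ y, pY y = ∫ x, φ (y - x) * p x)
    (hpY_pos : ∀ y, 0 < pY y)
    (μ₁ : ℝ → ℝ) (hμ₁ : ∀ y, μ₁ y = (∫ x, x * φ (y - x) * p x) / pY y)
    (m₂ : ℝ → ℝ) (hm₂ : ∀ y, m₂ y = (∫ x, x ^ 2 * φ (y - x) * p x) / pY y)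
    (y : ℝ) :
    DifferentiableAt ℝ μ₁ y ∧ deriv μ₁ y = (1 / σ ^ 2) * (m₂ y - (μ₁ y) ^ 2) := by
  have hp : Integrable p := by
    by_contra h
    rw [integral_undef h] at hp_int
    exact zero_ne_one hp_int
  have hxp : Integrable (fun x ↦ x * p x) :=
    integrable_continuous_mul_of_hasCompactSupport_s2 continuous_id hp hp_supp
  have hxxp : Integrable (fun x ↦ x * (x * p x)) :=
    integrable_continuous_mul_of_hasCompactSupport_s2 continuous_id hxp hp_supp.mul_left
  set A : ℝ := (2 * π * σ ^ 2) ^ (-(1 : ℝ) / 2)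
  have hφ_mul : ∀ (r : ℝ → ℝ) (z : ℝ), ∫ x, φ (z - x) * r x =
      A * ∫ x, rexp (-(z - x) ^ 2 / (2 * σ ^ 2)) * r x := fun r z ↦ by
    rw [← integral_const_mul]
    simp only [hφ, mul_assoc]
  have hderiv : ∀ {r : ℝ → ℝ}, Integrable r → Integrable (fun x ↦ x * r x) →
      HasDerivAt (fun z ↦ ∫ x, φ (z - x) * r x)
        ((1 / σ ^ 2) * ((∫ x, φ (y - x) * (x * r x)) - y * ∫ x, φ (y - x) * r x)) y :=
    fun hr hxr ↦ by
      simp only [hφ_mul]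
      exact ((hasDerivAt_integral_gaussian_mul hσ hr hxr y).const_mul A).congr_deriv (by ring)
  have hμ₁' : μ₁ = fun z ↦ (∫ x, φ (z - x) * (x * p x)) / ∫ x, φ (z - x) * p x := by
    funext z
    rw [hμ₁, hpY]
    congr 2
    funext x
    ring
  have hm₂' : m₂ y = (∫ x, φ (y - x) * (x * (x * p x))) / ∫ x, φ (y - x) * p x := by
    rw [hm₂, hpY]
    congr 2
    funext x
    ring
  have hne : (∫ x, φ (y - x) * p x) ≠ 0 := hpY y ▸ (hpY_pos y).ne'
  have h : HasDerivAt μ₁ ((1 / σ ^ 2) * (m₂ y - (μ₁ y) ^ 2)) y := by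
    rw [hm₂', hμ₁']
    refine ((hderiv hxp hxxp).div (hderiv hp hxp) hne).congr_deriv ?_
    field_simp
    ring
  exact ⟨h.differentiableAt, h.deriv⟩
end

section
/- For every y ∈ ℝ, the second posterior central moment μ₂ is differentiable at y and the third posterior central moment satisfies μ₃(y) = σ² · μ₂'(y). -/
open MeasureTheory Real

/-- A continuous function times an integrable function of compact support is integrable. -/
lemma Continuous.integrable_mul_of_hasCompactSupport {g f : ℝ → ℝ} (hg : Continuous g)
    (hf : Integrable f) (hfs : HasCompactSupport f) : Integrable fun x => g x * f x := by
  refine (integrableOn_iff_integrable_of_support_subset (s := tsupport f) fun x hx => ?_).1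
    (hf.integrableOn.continuousOn_mul hg.continuousOn hfs.isCompact)
  exact subset_tsupport f (right_ne_zero_of_mul hx)

/-- Differentiation under the integral sign for the convolution of a `C¹` function with an
integrable function of compact support. -/
lemma hasDerivAt_integral_comp_sub_mul {φ φ' f : ℝ → ℝ} (hφ : ∀ t, HasDerivAt φ (φ' t) t)
    (hφ' : Continuous φ') (hf : Integrable f) (hfs : HasCompactSupport f) (y : ℝ) :
    HasDerivAt (fun z => ∫ x, φ (z - x) * f x) (∫ x, φ' (y - x) * f x) y := by
  have hφc : Continuous φ := continuous_iff_continuousAt.2 fun t => (hφ t).continuousAt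
  have hint : ∀ {ψ : ℝ → ℝ}, Continuous ψ → ∀ z, Integrable fun x => ψ (z - x) * f x :=
    fun hψ z => Continuous.integrable_mul_of_hasCompactSupport
      (hψ.comp (continuous_const.sub continuous_id)) hf hfs
  obtain ⟨C, hC⟩ := ((isCompact_closedBall y 1).prod hfs.isCompact).exists_bound_of_continuousOn
    (f := fun q : ℝ × ℝ => φ' (q.1 - q.2)) (by fun_prop)
  refine (hasDerivAt_integral_of_dominated_loc_of_deriv_le (bound := fun x => C * ‖f x‖)
    (F := fun z x => φ (z - x) * f x) (F' := fun z x => φ' (z - x) * f x)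
    (Metric.closedBall_mem_nhds y one_pos)
    (.of_forall fun z => (hint hφc z).aestronglyMeasurable) (hint hφc y)
    (hint hφ' y).aestronglyMeasurable (.of_forall fun x z hz => ?_)
    (hf.norm.const_mul C) (.of_forall fun x z _ => ?_)).2
  · rw [norm_mul]
    by_cases hx : x ∈ tsupport f
    · exact mul_le_mul_of_nonneg_right (hC (z, x) ⟨hz, hx⟩) (norm_nonneg _)
    · simp [image_eq_zero_of_notMem_tsupport hx]
  · simpa using ((hφ (z - x)).comp z ((hasDerivAt_id z).sub_const x)).mul_const (f x)

/-- For every `y`, the second posterior central moment `μ₂` is differentiable at `y` and the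
third posterior central moment satisfies `μ₃ y = σ² * μ₂' y`. -/
theorem third_central_moment_eq_deriv_second
    (σ : ℝ) (hσ : 0 < σ)
    (p : ℝ → ℝ) (hp_meas : Measurable p) (hp_nonneg : ∀ x, 0 ≤ p x)
    (hp_bdd : ∃ C, ∀ x, p x ≤ C) (hp_supp : HasCompactSupport p)
    (hp_int : ∫ x, p x = 1)
    (φ : ℝ → ℝ)
    (hφ : ∀ t, φ t = (2 * π * σ ^ 2) ^ (-(1 : ℝ) / 2) * Real.exp (-t ^ 2 / (2 * σ ^ 2)))
    (pY : ℝ → ℝ) (hpY : ∀ y, pY y = ∫ x, φ (y - x) * p x)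
    (hpY_pos : ∀ y, 0 < pY y)
    (μ₁ : ℝ → ℝ) (hμ₁ : ∀ y, μ₁ y = (∫ x, x * φ (y - x) * p x) / pY y)
    (μ : ℕ → ℝ → ℝ)
    (hμ : ∀ k, 2 ≤ k → ∀ y, μ k y = (∫ x, (x - μ₁ y) ^ k * φ (y - x) * p x) / pY y)
    (y : ℝ) :
    DifferentiableAt ℝ (μ 2) y ∧ μ 3 y = σ ^ 2 * deriv (μ 2) y := by
  have hφd : ∀ t, HasDerivAt φ (-t / σ ^ 2 * φ t) t := by
    intro t
    have h := ((((hasDerivAt_id t).pow 2).neg.div_const (2 * σ ^ 2)).exp).const_mul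
      ((2 * π * σ ^ 2) ^ (-(1 : ℝ) / 2))
    rw [funext hφ]
    refine h.congr_deriv ?_
    simp
    field_simp
  have hφc : Continuous φ := continuous_iff_continuousAt.2 fun t => (hφd t).continuousAt
  have hp : Integrable p := integrable_of_integral_eq_one hp_int
  have hint : ∀ k z, Integrable fun x => x ^ k * φ (z - x) * p x := fun k z =>
    Continuous.integrable_mul_of_hasCompactSupport (by fun_prop) hp hp_supp
  set M : ℕ → ℝ → ℝ := fun k z => ∫ x, x ^ k * φ (z - x) * p x with hM
  have hMd : ∀ k z, HasDerivAt (M k) ((M (k + 1) z - z * M k z) / σ ^ 2) z := by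
    intro k z
    have h := hasDerivAt_integral_comp_sub_mul hφd (by fun_prop)
      (Continuous.integrable_mul_of_hasCompactSupport (continuous_pow k) hp hp_supp)
      (HasCompactSupport.mul_left (f := fun x : ℝ => x ^ k) hp_supp) z
    convert h using 1
    · ext w
      exact integral_congr_ae (.of_forall fun x => by ring)
    · simp only [hM]
      rw [← integral_const_mul, ← integral_sub (hint _ z) ((hint _ z).const_mul z),
        ← integral_div]
      exact integral_congr_ae (.of_forall fun x => by ring)
  have hY : ∀ z, pY z = M 0 z := fun z => by simp [hpY, hM]
  have hM0 : ∀ z, M 0 z ≠ 0 := fun z => hY z ▸ (hpY_pos z).ne'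
  have h1 : ∀ z, μ₁ z = M 1 z / M 0 z := fun z => by simp [hμ₁, hY, hM]
  have hcentral : ∀ k z m, ∫ x, (x - m) ^ k * φ (z - x) * p x
      = ∑ j ∈ Finset.range (k + 1), (-m) ^ (k - j) * (k.choose j) * M j z := by
    intro k z m
    simp only [hM, ← integral_const_mul]
    rw [← integral_finsetSum _ fun j _ => (hint j z).const_mul _]
    refine integral_congr_ae (.of_forall fun x => ?_)
    simp only [sub_eq_add_neg x m, add_pow, Finset.sum_mul]
    exact Finset.sum_congr rfl fun j _ => by ring
  have h2 : ∀ z, μ 2 z = M 2 z / M 0 z - (M 1 z / M 0 z) ^ 2 := by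
    intro z
    have := hM0 z
    rw [hμ 2 le_rfl, hcentral, hY, h1]
    simp [Finset.sum_range_succ]
    field_simp
    ring
  have h3 : μ 3 y = (M 3 y - 3 * μ₁ y * M 2 y + 3 * μ₁ y ^ 2 * M 1 y - μ₁ y ^ 3 * M 0 y)
      / M 0 y := by
    rw [hμ 3 (by norm_num), hcentral, hY]
    simp [Finset.sum_range_succ, Nat.choose]
    ring
  have hd := ((hMd 2 y).div (hMd 0 y) (hM0 y)).sub
    (((hMd 1 y).div (hMd 0 y) (hM0 y)).pow 2)
  have hd2 : HasDerivAt (μ 2) (μ 3 y / σ ^ 2) y := by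
    rw [funext h2]
    refine hd.congr_deriv ?_
    rw [h3, h1]
    have := hM0 y
    simp only [Pi.div_apply, zero_add, Nat.reduceAdd, Nat.cast_ofNat, Nat.reduceSub, pow_one]
    field_simp
    ring
  refine ⟨hd2.differentiableAt, ?_⟩
  rw [hd2.deriv]
  field_simp
end

section
/- For every y ∈ ℝ^d and every index i ∈ {1,…,d}, the partial derivative of p_Y with respect to y_i exists and satisfies the multivariate Tweedie identity ∂p_Y(y)/∂y_i = p_Y(y) · ([μ₁(y)]_i − y_i) / σ². Equivalently, ∇ log p_Y(y) = (μ₁(y) − y) / σ². -/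
open MeasureTheory Real

section GaussianConvolution

variable {ι : Type*} [Fintype ι]

theorem abs_mul_exp_neg_sum_sq_le {σ : ℝ} (hσ : 0 < σ) (u : ι → ℝ) (i : ι) :
    |u i| * exp (-(∑ j, u j ^ 2) / (2 * σ ^ 2)) ≤ σ := by
  have hsum : u i ^ 2 ≤ ∑ j, u j ^ 2 :=
    Finset.single_le_sum (f := fun j => u j ^ 2) (fun j _ => sq_nonneg _) (Finset.mem_univ i)
  have hexp : |u i| / σ ≤ exp ((∑ j, u j ^ 2) / (2 * σ ^ 2)) := by
    calc |u i| / σ ≤ (|u i| / σ) ^ 2 / 2 + 1 := by nlinarith [sq_nonneg (|u i| / σ - 1)]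
      _ = u i ^ 2 / (2 * σ ^ 2) + 1 := by rw [div_pow, sq_abs]; ring
      _ ≤ (∑ j, u j ^ 2) / (2 * σ ^ 2) + 1 := by gcongr
      _ ≤ _ := add_one_le_exp _
  rw [neg_div, exp_neg, ← div_eq_mul_inv, div_le_iff₀ (exp_pos _)]
  rwa [div_le_iff₀' hσ] at hexp

theorem exp_neg_sum_sq_le_one (σ : ℝ) (u : ι → ℝ) :
    exp (-(∑ j, u j ^ 2) / (2 * σ ^ 2)) ≤ 1 := by
  rw [exp_le_one_iff, neg_div, neg_nonpos]
  positivity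

theorem integrable_exp_neg_sum_sq_mul {p : (ι → ℝ) → ℝ} (hp : Integrable p) (σ : ℝ)
    (y : ι → ℝ) :
    Integrable fun x => exp (-(∑ j, (y j - x j) ^ 2) / (2 * σ ^ 2)) * p x := by
  refine hp.bdd_mul (c := 1) (Continuous.aestronglyMeasurable (by fun_prop)) (.of_forall fun x => ?_)
  rw [norm_of_nonneg (exp_pos _).le]
  exact exp_neg_sum_sq_le_one σ (y - x)

variable [DecidableEq ι]

theorem hasDerivAt_exp_neg_sum_sq_update {σ : ℝ} (hσ : σ ≠ 0) (x y : ι → ℝ) (i : ι) (t : ℝ) :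
    HasDerivAt
      (fun s => exp (-(∑ j, (Function.update y i s j - x j) ^ 2) / (2 * σ ^ 2)))
      ((x i - t) / σ ^ 2 *
        exp (-(∑ j, (Function.update y i t j - x j) ^ 2) / (2 * σ ^ 2))) t := by
  have hupd (j : ι) : HasDerivAt (fun s => Function.update y i s j) (Pi.single (M := fun _ => ℝ) i 1 j) t :=
    hasDerivAt_pi.mp (hasDerivAt_update y i t) j
  have hsum := HasDerivAt.fun_sum (u := Finset.univ)
    fun j _ => ((hupd j).sub_const (x j)).pow 2
  refine (hsum.neg.div_const (2 * σ ^ 2)).exp.congr_deriv ?_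
  have hval : ∑ j, ((2 : ℕ) : ℝ) * (Function.update y i t j - x j) ^ (2 - 1) *
      Pi.single (M := fun _ => ℝ) i 1 j = 2 * (t - x i) := by
    rw [Finset.sum_eq_single i (fun j _ hj => by simp [hj]) (by simp)]
    simp
  rw [hval]
  simp only [Pi.neg_apply, Pi.pow_apply]
  field_simp
  ring

/-- Differentiation under the integral sign for the convolution of an integrable function with
an unnormalized Gaussian. -/
theorem hasDerivAt_integral_exp_neg_sum_sq_mul {p : (ι → ℝ) → ℝ} (hp : Integrable p)
    {σ : ℝ} (hσ : 0 < σ) (y : ι → ℝ) (i : ι) :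
    Integrable (fun x => (x i - y i) / σ ^ 2 *
      exp (-(∑ j, (y j - x j) ^ 2) / (2 * σ ^ 2)) * p x) ∧
    HasDerivAt
      (fun t => ∫ x, exp (-(∑ j, (Function.update y i t j - x j) ^ 2) / (2 * σ ^ 2)) * p x)
      (∫ x, (x i - y i) / σ ^ 2 * exp (-(∑ j, (y j - x j) ^ 2) / (2 * σ ^ 2)) * p x)
      (y i) := by
  have h := hasDerivAt_integral_of_dominated_loc_of_deriv_le (μ := volume) (x₀ := y i)
    (F := fun t x => exp (-(∑ j, (Function.update y i t j - x j) ^ 2) / (2 * σ ^ 2)) * p x)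
    (F' := fun t x => (x i - t) / σ ^ 2 *
      exp (-(∑ j, (Function.update y i t j - x j) ^ 2) / (2 * σ ^ 2)) * p x)
    (bound := fun x => σ / σ ^ 2 * ‖p x‖) (s := Set.univ) Filter.univ_mem
    (.of_forall fun t => (integrable_exp_neg_sum_sq_mul hp σ _).aestronglyMeasurable)
    (integrable_exp_neg_sum_sq_mul hp σ _)
    (.mul (Continuous.aestronglyMeasurable (by fun_prop)) hp.aestronglyMeasurable)
    (.of_forall fun x t _ => ?_) (hp.norm.const_mul _)
    (.of_forall fun x t _ => (hasDerivAt_exp_neg_sum_sq_update hσ.ne' x y i t).mul_const _)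
  · simpa only [Function.update_eq_self] using h
  · have hb := abs_mul_exp_neg_sum_sq_le hσ (Function.update y i t - x) i
    simp only [Pi.sub_apply, Function.update_self] at hb
    rw [norm_mul, norm_mul, norm_div, norm_of_nonneg (exp_pos _).le,
      norm_of_nonneg (sq_nonneg σ), norm_eq_abs (x i - t), abs_sub_comm, div_mul_eq_mul_div]
    gcongr

end GaussianConvolution

/-- **Multivariate Tweedie identity.** For every `y ∈ ℝᵈ` and index `i`, the partial
derivative `∂pY/∂yᵢ` exists and equals `pY y * ((μ₁ y)ᵢ - yᵢ) / σ²`. -/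
theorem tweedie_multivariate
    (d : ℕ) (hd : 1 ≤ d)
    (σ : ℝ) (hσ : 0 < σ)
    (p : (Fin d → ℝ) → ℝ) (hp_meas : Measurable p) (hp_nonneg : ∀ x, 0 ≤ p x)
    (hp_bdd : ∃ C, ∀ x, p x ≤ C) (hp_supp : HasCompactSupport p)
    (hp_int : ∫ x, p x = 1)
    (φ : (Fin d → ℝ) → ℝ)
    (hφ : ∀ u, φ u = (2 * π * σ ^ 2) ^ (-(d : ℝ) / 2) *
      Real.exp (-(∑ i, u i ^ 2) / (2 * σ ^ 2)))
    (pY : (Fin d → ℝ) → ℝ) (hpY : ∀ y, pY y = ∫ x, φ (y - x) * p x)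
    (hpY_pos : ∀ y, 0 < pY y)
    (μ₁ : (Fin d → ℝ) → Fin d → ℝ)
    (hμ₁ : ∀ y i, μ₁ y i = (∫ x, x i * φ (y - x) * p x) / pY y)
    (y : Fin d → ℝ) (i : Fin d) :
    HasDerivAt (fun t => pY (Function.update y i t))
      (pY y * (μ₁ y i - y i) / σ ^ 2) (y i) := by
  have hp : Integrable p := .of_integral_ne_zero (by simp [hp_int])
  obtain ⟨hInt, hderiv⟩ := hasDerivAt_integral_exp_neg_sum_sq_mul hp hσ y i
  set A : ℝ := (2 * π * σ ^ 2) ^ (-(d : ℝ) / 2)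
  have hpY' (z : Fin d → ℝ) :
      pY z = A * ∫ x, exp (-(∑ j, (z j - x j) ^ 2) / (2 * σ ^ 2)) * p x := by
    simp only [hpY, hφ, Pi.sub_apply, mul_assoc, integral_const_mul]
  have hmul : pY y * μ₁ y i = ∫ x, x i * φ (y - x) * p x := by
    rw [hμ₁, mul_div_cancel₀ _ (hpY_pos y).ne']
  have hsplit : ∫ x, x i * φ (y - x) * p x =
      σ ^ 2 * A * (∫ x, (x i - y i) / σ ^ 2 *
        exp (-(∑ j, (y j - x j) ^ 2) / (2 * σ ^ 2)) * p x) + y i * pY y := by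
    rw [hpY', ← mul_assoc, ← integral_const_mul, ← integral_const_mul, ← integral_add
      (hInt.const_mul _) ((integrable_exp_neg_sum_sq_mul hp σ y).const_mul _)]
    congr 1 with x
    simp only [hφ, Pi.sub_apply]
    field_simp
    ring
  simp only [hpY' (Function.update y i _)]
  refine (hderiv.const_mul A).congr_deriv ?_
  rw [mul_sub, hmul, hsplit]
  field_simp
  ring
end

section
/- For every y ∈ ℝ^d and all indices i₁, i₂ ∈ {1,…,d}, the partial derivative ∂[μ₁(y)]_{i₁}/∂y_{i₂} exists and the posterior covariance satisfies [μ₂(y)]_{i₁,i₂} = σ² · ∂[μ₁(y)]_{i₁}/∂y_{i₂}. Equivalently, the posterior covariance matrix equals σ² times the Jacobian of the posterior mean: μ₂(y) = σ² · ∂μ₁(y)/∂y. -/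
open MeasureTheory Real

/-- Differentiation under the integral sign against a compactly supported integrable weight, for
a kernel that is jointly continuous together with its derivative in the parameter. -/
theorem hasDerivAt_integral_mul_of_hasCompactSupport {E : Type*} [TopologicalSpace E]
    [MeasurableSpace E] [OpensMeasurableSpace E] [SecondCountableTopologyEither E ℝ]
    {ν : Measure E} {p : E → ℝ} (hp : Integrable p ν) (hsupp : HasCompactSupport p)
    {g g' : ℝ → E → ℝ} (hg : Continuous fun z : ℝ × E => g z.1 z.2)
    (hg' : Continuous fun z : ℝ × E => g' z.1 z.2)
    (hderiv : ∀ t x, HasDerivAt (fun s => g s x) (g' t x) t) (t₀ : ℝ) :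
    HasDerivAt (fun t => ∫ x, g t x * p x ∂ν) (∫ x, g' t₀ x * p x ∂ν) t₀ := by
  have hmeas : ∀ {h : ℝ → E → ℝ}, (Continuous fun z : ℝ × E => h z.1 z.2) → ∀ t,
      AEStronglyMeasurable (fun x => h t x * p x) ν := fun {h} hh t =>
    (hh.comp (Continuous.prodMk_right t)).aestronglyMeasurable.mul hp.aestronglyMeasurable
  have hbound : ∀ {h : ℝ → E → ℝ}, (Continuous fun z : ℝ × E => h z.1 z.2) →
      ∃ C, ∀ t ∈ Metric.ball t₀ 1, ∀ x, ‖h t x * p x‖ ≤ C * ‖p x‖ := by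
    intro h hh
    obtain ⟨C, hC⟩ := ((isCompact_closedBall t₀ 1).prod hsupp).exists_bound_of_continuousOn
      hh.continuousOn
    refine ⟨C, fun t ht x => ?_⟩
    by_cases hx : x ∈ tsupport p
    · rw [norm_mul]
      gcongr
      exact hC (t, x) ⟨Metric.ball_subset_closedBall ht, hx⟩
    · simp [image_eq_zero_of_notMem_tsupport hx]
  obtain ⟨C, hC⟩ := hbound hg
  obtain ⟨C', hC'⟩ := hbound hg'
  exact (hasDerivAt_integral_of_dominated_loc_of_deriv_le (Metric.ball_mem_nhds t₀ one_pos)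
    (.of_forall (hmeas hg))
    ((hp.norm.const_mul C).mono' (hmeas hg t₀)
      (.of_forall (hC t₀ (Metric.mem_ball_self one_pos))))
    (hmeas hg' t₀)
    (.of_forall fun x t ht => hC' t ht x) (hp.norm.const_mul C')
    (.of_forall fun x t _ => (hderiv t x).mul_const (p x))).2

/-- The posterior covariance equals `σ²` times the Jacobian of the posterior mean:
for all indices `i₁, i₂`, `∂(μ₁)_{i₁}/∂y_{i₂}` exists and
`(μ₂ y)_{i₁,i₂} = σ² * ∂(μ₁ y)_{i₁}/∂y_{i₂}`. -/
theorem posterior_covariance_eq_jacobian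
    (d : ℕ) (hd : 1 ≤ d)
    (σ : ℝ) (hσ : 0 < σ)
    (p : (Fin d → ℝ) → ℝ) (hp_meas : Measurable p) (hp_nonneg : ∀ x, 0 ≤ p x)
    (hp_bdd : ∃ C, ∀ x, p x ≤ C) (hp_supp : HasCompactSupport p)
    (hp_int : ∫ x, p x = 1)
    (φ : (Fin d → ℝ) → ℝ)
    (hφ : ∀ u, φ u = (2 * π * σ ^ 2) ^ (-(d : ℝ) / 2) *
      Real.exp (-(∑ i, u i ^ 2) / (2 * σ ^ 2)))
    (pY : (Fin d → ℝ) → ℝ) (hpY : ∀ y, pY y = ∫ x, φ (y - x) * p x)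
    (hpY_pos : ∀ y, 0 < pY y)
    (μ₁ : (Fin d → ℝ) → Fin d → ℝ)
    (hμ₁ : ∀ y i, μ₁ y i = (∫ x, x i * φ (y - x) * p x) / pY y)
    (μ₂ : (Fin d → ℝ) → Fin d → Fin d → ℝ)
    (hμ₂ : ∀ y i₁ i₂, μ₂ y i₁ i₂ =
      (∫ x, (x i₁ - μ₁ y i₁) * (x i₂ - μ₁ y i₂) * φ (y - x) * p x) / pY y)
    (y : Fin d → ℝ) (i₁ i₂ : Fin d) :
    DifferentiableAt ℝ (fun t => μ₁ (Function.update y i₂ t) i₁) (y i₂) ∧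
    μ₂ y i₁ i₂ = σ ^ 2 * deriv (fun t => μ₁ (Function.update y i₂ t) i₁) (y i₂) := by
  have hpi : Integrable p := by
    by_contra h
    simp [integral_undef h] at hp_int
  have hφc : Continuous φ := by
    rw [funext hφ]
    fun_prop
  have hint : ∀ f : (Fin d → ℝ) → ℝ, Continuous f →
      Integrable (fun x => f x * φ (y - x) * p x) := by
    intro f hf
    have hc : Continuous fun x => f x * φ (y - x) := by fun_prop
    have hon := (hpi.integrableOn (s := tsupport p)).continuousOn_mul hc.continuousOn hp_supp
    refine (integrableOn_iff_integrable_of_support_subset ?_).1 hon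
    exact (Function.support_mul_subset_right _ _).trans (subset_tsupport p)
  have hφd : ∀ x t, HasDerivAt (fun s => φ (Function.update y i₂ s - x))
      ((x i₂ - t) / σ ^ 2 * φ (Function.update y i₂ t - x)) t := by
    intro x t
    have hsq : HasDerivAt (fun s => ∑ i, (Function.update y i₂ s - x) i ^ 2)
        (2 * (t - x i₂)) t := by
      have hterm : ∀ i ∈ Finset.univ, HasDerivAt (fun s => (Function.update y i₂ s - x) i ^ 2)
          (if i = i₂ then 2 * (t - x i₂) else 0) t := by
        intro i _
        by_cases hi : i = i₂
        · subst hi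
          simpa using ((hasDerivAt_id t).sub_const (x i)).fun_pow 2
        · simpa [hi] using hasDerivAt_const t ((y i - x i) ^ 2)
      simpa using HasDerivAt.fun_sum hterm
    simp only [hφ]
    refine ((hsq.fun_neg.div_const (2 * σ ^ 2)).exp.const_mul
      ((2 * π * σ ^ 2) ^ (-(d : ℝ) / 2))).congr_deriv ?_
    field_simp
    ring
  have hmain : ∀ f : (Fin d → ℝ) → ℝ, Continuous f →
      HasDerivAt (fun t => ∫ x, f x * φ (Function.update y i₂ t - x) * p x)
        (((∫ x, f x * x i₂ * φ (y - x) * p x) - y i₂ * ∫ x, f x * φ (y - x) * p x) / σ ^ 2)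
        (y i₂) := by
    intro f hf
    have h := hasDerivAt_integral_mul_of_hasCompactSupport hpi hp_supp
      (g := fun t x => f x * φ (Function.update y i₂ t - x))
      (g' := fun t x => f x * ((x i₂ - t) / σ ^ 2 * φ (Function.update y i₂ t - x)))
      (by fun_prop) (by fun_prop) (fun t x => (hφd x t).const_mul (f x)) (y i₂)
    convert h using 1
    rw [← integral_const_mul, ← integral_sub (hint _ (by fun_prop)) ((hint f hf).const_mul _),
      ← integral_div]
    congr 1 with x
    rw [Function.update_eq_self]
    ring
  have hZ : HasDerivAt (fun t => pY (Function.update y i₂ t))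
      (((∫ x, x i₂ * φ (y - x) * p x) - y i₂ * pY y) / σ ^ 2) (y i₂) := by
    simpa [hpY] using hmain (fun _ => 1) continuous_const
  have hne := (hpY_pos y).ne'
  have hμ := (hmain (fun x => x i₁) (by fun_prop)).fun_div hZ (by simpa using hne)
  simp only [← hμ₁] at hμ
  refine ⟨hμ.differentiableAt, ?_⟩
  rw [hμ.deriv, Function.update_eq_self, hμ₂]
  have hexpand : (∫ x, (x i₁ - μ₁ y i₁) * (x i₂ - μ₁ y i₂) * φ (y - x) * p x) =
      (∫ x, x i₁ * x i₂ * φ (y - x) * p x) - μ₁ y i₂ * (∫ x, x i₁ * φ (y - x) * p x)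
        - μ₁ y i₁ * (∫ x, x i₂ * φ (y - x) * p x) + μ₁ y i₁ * μ₁ y i₂ * pY y := by
    have h0 : Integrable fun x => φ (y - x) * p x := by
      simpa using hint (fun _ => 1) continuous_const
    have h1 := (hint (fun x => x i₁) (by fun_prop)).const_mul (μ₁ y i₂)
    have h2 := (hint (fun x => x i₂) (by fun_prop)).const_mul (μ₁ y i₁)
    have h12 := hint (fun x => x i₁ * x i₂) (by fun_prop)
    rw [hpY, ← integral_const_mul, ← integral_const_mul, ← integral_const_mul,
      ← integral_sub h12 h1, ← integral_sub (h12.sub' h1) h2,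
      ← integral_add ((h12.sub' h1).sub' h2) (h0.const_mul _)]
    congr 1 with x
    ring
  rw [hexpand, hμ₁, hμ₁]
  field_simp
  ring
end

section
/- For every y ∈ ℝ^d and all indices i₁, i₂, i₃ ∈ {1,…,d}, the partial derivative ∂[μ₂(y)]_{i₁,i₂}/∂y_{i₃} exists and the third posterior central moment tensor satisfies [μ₃(y)]_{i₁,i₂,i₃} = σ² · ∂[μ₂(y)]_{i₁,i₂}/∂y_{i₃}. -/
open MeasureTheory Real

/-- A continuous function times an integrable compactly supported function is integrable. -/
lemma integrable_continuous_mul_of_hasCompactSupport_s10 {d : ℕ} {p h : (Fin d → ℝ) → ℝ}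
    (hp : Integrable p) (hp_supp : HasCompactSupport p) (hh : Continuous h) :
    Integrable (fun x => h x * p x) := by
  have h1 : IntegrableOn (fun x => h x * p x) (tsupport p) :=
    IntegrableOn.continuousOn_mul hh.continuousOn hp.integrableOn hp_supp
  refine (integrableOn_iff_integrable_of_support_subset ?_).1 h1
  intro x hx
  exact subset_tsupport p (right_ne_zero_of_mul hx)

/-- Partial derivative of a Gaussian kernel of variance `σ ^ 2` along a coordinate. -/
lemma hasDerivAt_gaussian_update {d : ℕ} {σ c : ℝ} (hσ : 0 < σ) {φ : (Fin d → ℝ) → ℝ}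
    (hφ : ∀ u, φ u = c * Real.exp (-(∑ i, u i ^ 2) / (2 * σ ^ 2)))
    (y x : Fin d → ℝ) (i : Fin d) (t : ℝ) :
    HasDerivAt (fun t => φ (Function.update y i t - x))
      ((x i - t) / σ ^ 2 * φ (Function.update y i t - x)) t := by
  have h1 : HasDerivAt (fun t => ∑ j, (Function.update y i t - x) j ^ 2)
      (2 * (t - x i)) t := by
    have h2 : ∀ j ∈ Finset.univ, HasDerivAt (fun t => (Function.update y i t - x) j ^ 2)
        (2 * (Function.update y i t - x) j * (Pi.single i 1 : Fin d → ℝ) j) t := by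
      intro j _
      have h3 := (((hasDerivAt_pi.1 (hasDerivAt_update y i t)) j).sub_const (x j)).fun_pow 2
      simpa using h3
    refine (HasDerivAt.fun_sum h2).congr_deriv ?_
    simp [Pi.single_apply]
  simp only [hφ]
  refine (((h1.fun_neg.div_const (2 * σ ^ 2)).exp).const_mul c).congr_deriv ?_
  field_simp
  ring

/-- Partial derivative of a moment integral against a Gaussian kernel. -/
lemma hasDerivAt_integral_gaussian_update {d : ℕ} {σ c : ℝ} (hσ : 0 < σ)
    {φ : (Fin d → ℝ) → ℝ}
    (hφ : ∀ u, φ u = c * Real.exp (-(∑ i, u i ^ 2) / (2 * σ ^ 2)))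
    {p g : (Fin d → ℝ) → ℝ} (hp : Integrable p) (hp_supp : HasCompactSupport p)
    (hg : Continuous g) (y : Fin d → ℝ) (i : Fin d) :
    HasDerivAt (fun t => ∫ x, g x * φ (Function.update y i t - x) * p x)
      (((∫ x, g x * x i * φ (y - x) * p x) - y i * ∫ x, g x * φ (y - x) * p x) / σ ^ 2)
      (y i) := by
  have hφc : Continuous φ := by
    rw [funext hφ]
    fun_prop
  have hφb : ∀ u, |φ u| ≤ |c| := by
    intro u
    rw [hφ, abs_mul, abs_of_pos (Real.exp_pos _)]
    refine mul_le_of_le_one_right (abs_nonneg c) (Real.exp_le_one_iff.2 ?_)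
    rw [neg_div]
    exact neg_nonpos.2 (div_nonneg (Finset.sum_nonneg fun j _ => sq_nonneg _) (by positivity))
  have hint : ∀ {h : (Fin d → ℝ) → ℝ}, Continuous h → Integrable (fun x => h x * p x) :=
    fun hh => integrable_continuous_mul_of_hasCompactSupport_s10 hp hp_supp hh
  have key := (hasDerivAt_integral_of_dominated_loc_of_deriv_le (μ := volume)
    (F := fun t x => g x * φ (Function.update y i t - x) * p x)
    (F' := fun t x => g x * ((x i - t) / σ ^ 2 * φ (Function.update y i t - x)) * p x)
    (x₀ := y i) (s := Metric.ball (y i) 1)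
    (bound := fun x => |g x * ((|x i| + (|y i| + 1)) / σ ^ 2 * |c|) * p x|)
    (Metric.ball_mem_nhds _ one_pos)
    (Filter.Eventually.of_forall fun t => (hint (by fun_prop)).aestronglyMeasurable)
    (hint (by fun_prop))
    (hint (by fun_prop)).aestronglyMeasurable
    (Filter.Eventually.of_forall fun x t ht => ?_)
    (hint (by fun_prop)).abs
    (Filter.Eventually.of_forall fun x t _ => ?_)).2
  · refine key.congr_deriv ?_
    rw [← integral_const_mul, ← integral_sub (hint (by fun_prop))
      ((hint (by fun_prop)).const_mul _), ← integral_div]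
    congr 1
    funext x
    rw [Function.update_eq_self]
    ring
  · have ht' : |x i - t| ≤ |x i| + (|y i| + 1) := by
      rw [Metric.mem_ball, Real.dist_eq] at ht
      have h1 := abs_sub (x i) t
      have h2 := abs_sub_abs_le_abs_sub t (y i)
      linarith
    simp only [Real.norm_eq_abs, abs_mul, abs_div, abs_abs]
    rw [abs_of_nonneg (by positivity : 0 ≤ |x i| + (|y i| + 1))]
    have h3 := hφb (Function.update y i t - x)
    gcongr
  · exact ((hasDerivAt_gaussian_update hσ hφ y x i t).const_mul (g x)).mul_const (p x)

/-- The third posterior central moment tensor equals `σ²` times the partial derivative of the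
posterior covariance: `(μ₃ y)_{i₁,i₂,i₃} = σ² * ∂(μ₂ y)_{i₁,i₂}/∂y_{i₃}`. -/
theorem third_moment_tensor_eq_deriv_covariance
    (d : ℕ) (hd : 1 ≤ d)
    (σ : ℝ) (hσ : 0 < σ)
    (p : (Fin d → ℝ) → ℝ) (hp_meas : Measurable p) (hp_nonneg : ∀ x, 0 ≤ p x)
    (hp_bdd : ∃ C, ∀ x, p x ≤ C) (hp_supp : HasCompactSupport p)
    (hp_int : ∫ x, p x = 1)
    (φ : (Fin d → ℝ) → ℝ)
    (hφ : ∀ u, φ u = (2 * π * σ ^ 2) ^ (-(d : ℝ) / 2) *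
      Real.exp (-(∑ i, u i ^ 2) / (2 * σ ^ 2)))
    (pY : (Fin d → ℝ) → ℝ) (hpY : ∀ y, pY y = ∫ x, φ (y - x) * p x)
    (hpY_pos : ∀ y, 0 < pY y)
    (μ₁ : (Fin d → ℝ) → Fin d → ℝ)
    (hμ₁ : ∀ y i, μ₁ y i = (∫ x, x i * φ (y - x) * p x) / pY y)
    (μ₂ : (Fin d → ℝ) → Fin d → Fin d → ℝ)
    (hμ₂ : ∀ y i₁ i₂, μ₂ y i₁ i₂ =
      (∫ x, (x i₁ - μ₁ y i₁) * (x i₂ - μ₁ y i₂) * φ (y - x) * p x) / pY y)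
    (μ₃ : (Fin d → ℝ) → Fin d → Fin d → Fin d → ℝ)
    (hμ₃ : ∀ y i₁ i₂ i₃, μ₃ y i₁ i₂ i₃ =
      (∫ x, (x i₁ - μ₁ y i₁) * (x i₂ - μ₁ y i₂) * (x i₃ - μ₁ y i₃) * φ (y - x) * p x) / pY y)
    (y : Fin d → ℝ) (i₁ i₂ i₃ : Fin d) :
    DifferentiableAt ℝ (fun t => μ₂ (Function.update y i₃ t) i₁ i₂) (y i₃) ∧
    μ₃ y i₁ i₂ i₃ = σ ^ 2 * deriv (fun t => μ₂ (Function.update y i₃ t) i₁ i₂) (y i₃) := by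
  have hp : Integrable p := by
    by_contra h
    rw [integral_undef h] at hp_int
    exact zero_ne_one hp_int
  have hφc : Continuous φ := by
    rw [funext hφ]
    fun_prop
  have hint : ∀ (z : Fin d → ℝ) {g : (Fin d → ℝ) → ℝ}, Continuous g →
      Integrable (fun x => g x * φ (z - x) * p x) :=
    fun z g hg => integrable_continuous_mul_of_hasCompactSupport_s10 hp hp_supp
      (h := fun x => g x * φ (z - x)) (by fun_prop)
  have sd : ∀ {f g : (Fin d → ℝ) → ℝ}, Integrable f → Integrable g →
      Integrable (fun x => f x - g x) := Integrable.sub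
  have ad : ∀ {f g : (Fin d → ℝ) → ℝ}, Integrable f → Integrable g →
      Integrable (fun x => f x + g x) := Integrable.add
  have hpY' : ∀ z, pY z = ∫ x, 1 * φ (z - x) * p x := by simpa using hpY
  have hμ₂' : ∀ z, μ₂ z i₁ i₂ = (∫ x, x i₁ * x i₂ * φ (z - x) * p x) / pY z -
      (∫ x, x i₁ * φ (z - x) * p x) / pY z * ((∫ x, x i₂ * φ (z - x) * p x) / pY z) := by
    intro z
    have h0 := (hpY_pos z).ne'
    rw [← hμ₁, ← hμ₁, hμ₂]
    have h1 : ∫ x, (x i₁ - μ₁ z i₁) * (x i₂ - μ₁ z i₂) * φ (z - x) * p x =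
        (∫ x, x i₁ * x i₂ * φ (z - x) * p x) - μ₁ z i₂ * (∫ x, x i₁ * φ (z - x) * p x) -
        μ₁ z i₁ * (∫ x, x i₂ * φ (z - x) * p x) + μ₁ z i₁ * μ₁ z i₂ * pY z := by
      rw [hpY']
      simp only [← integral_const_mul]
      have e0 := hint z (g := fun x => x i₁ * x i₂) (by fun_prop)
      have e1 := (hint z (g := fun x => x i₁) (by fun_prop)).const_mul (μ₁ z i₂)
      have e2 := (hint z (g := fun x => x i₂) (by fun_prop)).const_mul (μ₁ z i₁)
      have e3 := (hint z (g := fun _ => 1) (by fun_prop)).const_mul (μ₁ z i₁ * μ₁ z i₂)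
      rw [← integral_sub e0 e1, ← integral_sub (sd e0 e1) e2,
        ← integral_add (sd (sd e0 e1) e2) e3]
      congr 1
      funext x
      ring
    rw [h1, hμ₁ z i₁, hμ₁ z i₂]
    field_simp
    ring
  have hμ₃' : μ₃ y i₁ i₂ i₃ * pY y = (∫ x, x i₁ * x i₂ * x i₃ * φ (y - x) * p x)
      - μ₁ y i₃ * (∫ x, x i₁ * x i₂ * φ (y - x) * p x)
      - μ₁ y i₂ * (∫ x, x i₁ * x i₃ * φ (y - x) * p x)
      - μ₁ y i₁ * (∫ x, x i₂ * x i₃ * φ (y - x) * p x)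
      + μ₁ y i₂ * μ₁ y i₃ * (∫ x, x i₁ * φ (y - x) * p x)
      + μ₁ y i₁ * μ₁ y i₃ * (∫ x, x i₂ * φ (y - x) * p x)
      + μ₁ y i₁ * μ₁ y i₂ * (∫ x, x i₃ * φ (y - x) * p x)
      - μ₁ y i₁ * μ₁ y i₂ * μ₁ y i₃ * pY y := by
    rw [hμ₃, div_mul_cancel₀ _ (hpY_pos y).ne', hpY']
    simp only [← integral_const_mul]
    have e0 := hint y (g := fun x => x i₁ * x i₂ * x i₃) (by fun_prop)
    have e1 := (hint y (g := fun x => x i₁ * x i₂) (by fun_prop)).const_mul (μ₁ y i₃)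
    have e2 := (hint y (g := fun x => x i₁ * x i₃) (by fun_prop)).const_mul (μ₁ y i₂)
    have e3 := (hint y (g := fun x => x i₂ * x i₃) (by fun_prop)).const_mul (μ₁ y i₁)
    have e4 := (hint y (g := fun x => x i₁) (by fun_prop)).const_mul (μ₁ y i₂ * μ₁ y i₃)
    have e5 := (hint y (g := fun x => x i₂) (by fun_prop)).const_mul (μ₁ y i₁ * μ₁ y i₃)
    have e6 := (hint y (g := fun x => x i₃) (by fun_prop)).const_mul (μ₁ y i₁ * μ₁ y i₂)
    have e7 := (hint y (g := fun _ => 1) (by fun_prop)).const_mul (μ₁ y i₁ * μ₁ y i₂ * μ₁ y i₃)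
    rw [← integral_sub e0 e1, ← integral_sub (sd e0 e1) e2,
      ← integral_sub (sd (sd e0 e1) e2) e3,
      ← integral_add (sd (sd (sd e0 e1) e2) e3) e4,
      ← integral_add (ad (sd (sd (sd e0 e1) e2) e3) e4) e5,
      ← integral_add (ad (ad (sd (sd (sd e0 e1) e2) e3) e4) e5) e6,
      ← integral_sub (ad (ad (ad (sd (sd (sd e0 e1) e2) e3) e4) e5) e6) e7]
    congr 1
    funext x
    ring
  have hD : ∀ {g : (Fin d → ℝ) → ℝ}, Continuous g → _ := fun {g} hg =>
    hasDerivAt_integral_gaussian_update hσ hφ hp hp_supp hg y i₃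
  have hD0 := hD (g := fun _ => 1) (by fun_prop)
  have hD1 := hD (g := fun x => x i₁) (by fun_prop)
  have hD2 := hD (g := fun x => x i₂) (by fun_prop)
  have hD12 := hD (g := fun x => x i₁ * x i₂) (by fun_prop)
  simp only [one_mul, ← hpY] at hD0
  have hne : pY (Function.update y i₃ (y i₃)) ≠ 0 := (hpY_pos _).ne'
  have hder := (hD12.fun_div hD0 hne).fun_sub
    ((hD1.fun_div hD0 hne).fun_mul (hD2.fun_div hD0 hne))
  simp only [← hμ₂', Function.update_eq_self] at hder
  refine ⟨hder.differentiableAt, ?_⟩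
  rw [hder.deriv]
  have h0 := (hpY_pos y).ne'
  rw [eq_div_of_mul_eq h0 hμ₃', hμ₁, hμ₁, hμ₁]
  field_simp
  ring
end

section
/- For every y ∈ ℝ^d and all indices i₁, i₂ ∈ {1,…,d}, the second partial derivative ∂² log p_Y(y) / (∂y_{i₁} ∂y_{i₂}) exists and the posterior covariance satisfies the second-order Tweedie relation [μ₂(y)]_{i₁,i₂} = σ⁴ · ∂² log p_Y(y)/(∂y_{i₁}∂y_{i₂}) + σ² · δ_{i₁ i₂}, where δ_{i₁ i₂} is the Kronecker delta. Equivalently, μ₂(y) = σ⁴ · ∇² log p_Y(y) + σ² · I. -/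
open MeasureTheory Real

/-- The Gaussian kernel of width `σ` with normalising constant `c`. -/
noncomputable def gaussianKernel {d : ℕ} (c σ : ℝ) (u : Fin d → ℝ) : ℝ :=
  c * Real.exp (-(∑ i, u i ^ 2) / (2 * σ ^ 2))

/-- The convolution of a weight `w` with the Gaussian kernel. -/
noncomputable def gaussianConv {d : ℕ} (c σ : ℝ) (w : (Fin d → ℝ) → ℝ) (y : Fin d → ℝ) : ℝ :=
  ∫ x, gaussianKernel c σ (y - x) * w x

lemma continuous_gaussianKernel {d : ℕ} (c σ : ℝ) :
    Continuous (gaussianKernel c σ : (Fin d → ℝ) → ℝ) := by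
  unfold gaussianKernel
  fun_prop

lemma abs_gaussianKernel_le {d : ℕ} (c σ : ℝ) (u : Fin d → ℝ) :
    |gaussianKernel c σ u| ≤ |c| := by
  rw [gaussianKernel, abs_mul, Real.abs_exp]
  refine mul_le_of_le_one_right (abs_nonneg c) (Real.exp_le_one_iff.mpr ?_)
  rw [neg_div]
  exact neg_nonpos.mpr (by positivity)

lemma hasDerivAt_gaussianKernel_update {d : ℕ} (c : ℝ) {σ : ℝ} (hσ : σ ≠ 0)
    (z x : Fin d → ℝ) (i : Fin d) (s : ℝ) :
    HasDerivAt (fun s => gaussianKernel c σ (Function.update z i s - x))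
      ((x i - s) / σ ^ 2 * gaussianKernel c σ (Function.update z i s - x)) s := by
  have hsum : HasDerivAt (fun s => ∑ j, (Function.update z i s - x) j ^ 2) (2 * (s - x i)) s := by
    have h : ∀ j ∈ Finset.univ, HasDerivAt (fun s => (Function.update z i s - x) j ^ 2)
        (if j = i then 2 * (s - x i) else 0) s := by
      intro j _
      by_cases hj : j = i
      · subst hj
        simpa using ((hasDerivAt_id' s).sub_const (x j)).fun_pow 2
      · simpa [hj] using hasDerivAt_const s ((z j - x j) ^ 2)
    simpa using HasDerivAt.fun_sum h
  refine ((hsum.fun_neg.div_const (2 * σ ^ 2)).exp.const_mul c).congr_deriv ?_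
  simp only [gaussianKernel]
  field_simp
  ring

lemma HasCompactSupport.exists_abs_coord_le {d : ℕ} {w : (Fin d → ℝ) → ℝ}
    (hs : HasCompactSupport w) : ∃ R : ℝ, ∀ x i, w x ≠ 0 → |x i| ≤ R := by
  obtain ⟨R, hR⟩ := hs.isCompact.isBounded.exists_norm_le
  exact ⟨R, fun x i hx => (norm_le_pi_norm x i).trans (hR x (subset_tsupport w hx))⟩

lemma MeasureTheory.Integrable.coord_mul {d : ℕ} {w : (Fin d → ℝ) → ℝ}
    (hw : Integrable w) (hs : HasCompactSupport w) (i : Fin d) :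
    Integrable (fun x => x i * w x) := by
  obtain ⟨R, hR⟩ := hs.exists_abs_coord_le
  refine (hw.norm.const_mul R).mono' ?_ (.of_forall fun x => ?_)
  · exact (continuous_apply i).aestronglyMeasurable.mul hw.aestronglyMeasurable
  · by_cases hx : w x = 0
    · simp [hx]
    · rw [norm_mul]
      exact mul_le_mul_of_nonneg_right (hR x i hx) (norm_nonneg _)

lemma MeasureTheory.Integrable.gaussianKernel_mul {d : ℕ} (c σ : ℝ) {w : (Fin d → ℝ) → ℝ}
    (hw : Integrable w) (y : Fin d → ℝ) :
    Integrable (fun x => gaussianKernel c σ (y - x) * w x) :=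
  hw.bdd_mul (c := |c|)
    ((continuous_gaussianKernel c σ).comp (continuous_const.sub continuous_id)).aestronglyMeasurable
    (.of_forall fun x => abs_gaussianKernel_le c σ (y - x))

/-- Differentiation under the integral sign for a Gaussian convolution. -/
lemma hasDerivAt_gaussianConv_update {d : ℕ} (c : ℝ) {σ : ℝ} (hσ : σ ≠ 0)
    {w : (Fin d → ℝ) → ℝ} (hw : Integrable w) (hs : HasCompactSupport w)
    (z : Fin d → ℝ) (i : Fin d) :
    HasDerivAt (fun s => gaussianConv c σ w (Function.update z i s))
      ((gaussianConv c σ (fun x => x i * w x) z - z i * gaussianConv c σ w z) / σ ^ 2) (z i) := by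
  obtain ⟨R, hR⟩ := hs.exists_abs_coord_le
  have hint := fun y => hw.gaussianKernel_mul c σ y
  have hint' := (hw.coord_mul hs i).gaussianKernel_mul c σ z
  have key := hasDerivAt_integral_of_dominated_loc_of_deriv_le (μ := volume)
    (F := fun s x => gaussianKernel c σ (Function.update z i s - x) * w x)
    (F' := fun s x => (x i - s) / σ ^ 2 * gaussianKernel c σ (Function.update z i s - x) * w x)
    (bound := fun x => (R + |z i| + 1) / σ ^ 2 * |c| * |w x|)
    (x₀ := z i) (Metric.ball_mem_nhds (z i) one_pos)
    (.of_forall fun s => (hint _).aestronglyMeasurable) (hint _)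
    ?_ (.of_forall fun x s hs' => ?_) (hw.abs.const_mul _)
    (.of_forall fun x s _ => (hasDerivAt_gaussianKernel_update c hσ z x i s).mul_const (w x))
  · refine key.2.congr_deriv ?_
    simp only [gaussianConv, Function.update_eq_self]
    rw [← integral_const_mul, ← integral_sub hint' ((hint z).const_mul _), ← integral_div]
    congr 1 with x
    ring
  · refine AEStronglyMeasurable.mul ?_ hw.aestronglyMeasurable
    refine Continuous.aestronglyMeasurable ?_
    exact (by fun_prop : Continuous fun x : Fin d → ℝ => (x i - z i) / σ ^ 2).mul
      ((continuous_gaussianKernel c σ).comp (continuous_const.sub continuous_id))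
  · by_cases hx : w x = 0
    · simp [hx]
    · have h1 : |s - z i| < 1 := by simpa [Real.dist_eq] using hs'
      have h2 : |x i - s| ≤ R + |z i| + 1 := by
        have h3 := abs_le.mp (hR x i hx)
        have h4 := abs_lt.mp h1
        have h5 := abs_le.mp (le_refl |z i|)
        rw [abs_le]
        constructor <;> linarith
      rw [Real.norm_eq_abs, abs_mul, abs_mul, abs_div, abs_of_nonneg (sq_nonneg σ)]
      have hR0 : 0 ≤ (R + |z i| + 1) / σ ^ 2 :=
        div_nonneg ((abs_nonneg _).trans h2) (sq_nonneg σ)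
      exact mul_le_mul_of_nonneg_right
        (mul_le_mul (div_le_div_of_nonneg_right h2 (sq_nonneg σ))
          (abs_gaussianKernel_le c σ _) (abs_nonneg _) hR0) (abs_nonneg _)

/-- **Second-order Tweedie relation.** For every `y` and indices `i₁, i₂`, the mixed second
partial derivative `∂² log pY / (∂y_{i₁} ∂y_{i₂})` exists and the posterior covariance
satisfies `(μ₂ y)_{i₁,i₂} = σ⁴ ∂² log pY(y)/(∂y_{i₁}∂y_{i₂}) + σ² δ_{i₁ i₂}`. -/
theorem second_order_tweedie
    (d : ℕ) (hd : 1 ≤ d)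
    (σ : ℝ) (hσ : 0 < σ)
    (p : (Fin d → ℝ) → ℝ) (hp_meas : Measurable p) (hp_nonneg : ∀ x, 0 ≤ p x)
    (hp_bdd : ∃ C, ∀ x, p x ≤ C) (hp_supp : HasCompactSupport p)
    (hp_int : ∫ x, p x = 1)
    (φ : (Fin d → ℝ) → ℝ)
    (hφ : ∀ u, φ u = (2 * π * σ ^ 2) ^ (-(d : ℝ) / 2) *
      Real.exp (-(∑ i, u i ^ 2) / (2 * σ ^ 2)))
    (pY : (Fin d → ℝ) → ℝ) (hpY : ∀ y, pY y = ∫ x, φ (y - x) * p x)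
    (hpY_pos : ∀ y, 0 < pY y)
    (μ₁ : (Fin d → ℝ) → Fin d → ℝ)
    (hμ₁ : ∀ y i, μ₁ y i = (∫ x, x i * φ (y - x) * p x) / pY y)
    (μ₂ : (Fin d → ℝ) → Fin d → Fin d → ℝ)
    (hμ₂ : ∀ y i₁ i₂, μ₂ y i₁ i₂ =
      (∫ x, (x i₁ - μ₁ y i₁) * (x i₂ - μ₁ y i₂) * φ (y - x) * p x) / pY y)
    (y : Fin d → ℝ) (i₁ i₂ : Fin d) :
    (∀ z : Fin d → ℝ,
      DifferentiableAt ℝ (fun s => Real.log (pY (Function.update z i₂ s))) (z i₂)) ∧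
    DifferentiableAt ℝ
      (fun t => deriv
        (fun s => Real.log (pY (Function.update (Function.update y i₁ t) i₂ s)))
        (Function.update y i₁ t i₂))
      (y i₁) ∧
    μ₂ y i₁ i₂ =
      σ ^ 4 * deriv
        (fun t => deriv
          (fun s => Real.log (pY (Function.update (Function.update y i₁ t) i₂ s)))
          (Function.update y i₁ t i₂))
        (y i₁) +
      σ ^ 2 * (if i₁ = i₂ then (1 : ℝ) else 0) := by
  have hσ0 := hσ.ne'
  set c : ℝ := (2 * π * σ ^ 2) ^ (-(d : ℝ) / 2)
  obtain rfl : φ = gaussianKernel c σ := funext hφ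
  obtain rfl : pY = gaussianConv c σ p := funext hpY
  have hp : Integrable p := by
    by_contra h
    rw [integral_undef h] at hp_int
    exact zero_ne_one hp_int
  have hA (i) : Integrable (fun x => x i * p x) := hp.coord_mul hp_supp i
  have hAs (i : Fin d) : HasCompactSupport (fun x => x i * p x) := hp_supp.mul_left
  have hB := (hA i₂).coord_mul (hAs i₂) i₁
  have hm (z i) : μ₁ z i = gaussianConv c σ (fun x => x i * p x) z / gaussianConv c σ p z := by
    rw [hμ₁, gaussianConv]
    congr 2 with x
    ring
  have hlog (z : Fin d → ℝ) :
      HasDerivAt (fun s => Real.log (gaussianConv c σ p (Function.update z i₂ s)))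
        ((μ₁ z i₂ - z i₂) / σ ^ 2) (z i₂) := by
    have h0 := (hpY_pos z).ne'
    refine ((hasDerivAt_gaussianConv_update c hσ0 hp hp_supp z i₂).log
      (by simpa using h0)).congr_deriv ?_
    rw [hm, Function.update_eq_self]
    field_simp
  have hcoord : HasDerivAt (fun t => Function.update y i₁ t i₂)
      (if i₁ = i₂ then (1 : ℝ) else 0) (y i₁) := by
    by_cases h : i₁ = i₂
    · subst h
      simpa using hasDerivAt_id' (y i₁)
    · simpa [h, Function.update_of_ne (Ne.symm h)] using hasDerivAt_const (y i₁) (y i₂)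
  have h0 := (hpY_pos y).ne'
  have hcov : μ₂ y i₁ i₂ =
      gaussianConv c σ (fun x => x i₁ * (x i₂ * p x)) y / gaussianConv c σ p y -
        μ₁ y i₁ * μ₁ y i₂ := by
    have hexp : ∫ x, (x i₁ - μ₁ y i₁) * (x i₂ - μ₁ y i₂) * gaussianKernel c σ (y - x) * p x =
        gaussianConv c σ (fun x => x i₁ * (x i₂ * p x)) y
          - μ₁ y i₁ * gaussianConv c σ (fun x => x i₂ * p x) y
          - μ₁ y i₂ * gaussianConv c σ (fun x => x i₁ * p x) y
          + μ₁ y i₁ * μ₁ y i₂ * gaussianConv c σ p y := by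
      have hB' := hB.gaussianKernel_mul c σ y
      have hA₁ := ((hA i₁).gaussianKernel_mul c σ y).const_mul (μ₁ y i₂)
      have hA₂ := ((hA i₂).gaussianKernel_mul c σ y).const_mul (μ₁ y i₁)
      have hp' := (hp.gaussianKernel_mul c σ y).const_mul (μ₁ y i₁ * μ₁ y i₂)
      simp only [gaussianConv]
      rw [← integral_const_mul, ← integral_const_mul, ← integral_const_mul,
        ← integral_sub hB' hA₂, ← integral_sub (hB'.sub' hA₂) hA₁,
        ← integral_add ((hB'.sub' hA₂).sub' hA₁) hp']
      congr 1 with x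
      ring
    rw [hμ₂, hexp, hm, hm]
    field_simp
    ring
  have hsecond : HasDerivAt
      (fun t => deriv
        (fun s => Real.log (gaussianConv c σ p
          (Function.update (Function.update y i₁ t) i₂ s)))
        (Function.update y i₁ t i₂))
      ((μ₂ y i₁ i₂ / σ ^ 2 - (if i₁ = i₂ then (1 : ℝ) else 0)) / σ ^ 2) (y i₁) := by
    have hfun := fun t => (hlog (Function.update y i₁ t)).deriv
    simp only [hfun, hm]
    have hquot := (hasDerivAt_gaussianConv_update c hσ0 (hA i₂) (hAs i₂) y i₁).fun_div
      (hasDerivAt_gaussianConv_update c hσ0 hp hp_supp y i₁) (by simpa using h0)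
    refine ((hquot.fun_sub hcoord).div_const (σ ^ 2)).congr_deriv ?_
    rw [hcov, hm, hm, Function.update_eq_self]
    field_simp
    ring
  refine ⟨fun z => (hlog z).differentiableAt, hsecond.differentiableAt, ?_⟩
  rw [hsecond.deriv]
  field_simp
  ring
end

section
/- Let v ∈ ℝ^d be a fixed vector. For every y ∈ ℝ^d, the directional derivative D_v μ₁^v(y) = lim_{t→0} (μ₁^v(y + t v) − μ₁^v(y))/t exists, and the second directional posterior central moment satisfies μ₂^v(y) = σ² · D_v μ₁^v(y), where μ₁^v(y) = ⟨v, μ₁(y)⟩. -/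
open MeasureTheory Real

theorem integrable_continuous_mul_of_hasCompactSupport_s14 {E : Type*} [TopologicalSpace E]
    [T2Space E] [MeasurableSpace E] [OpensMeasurableSpace E] {μ : Measure E} {p g : E → ℝ}
    (hp : Integrable p μ) (hs : HasCompactSupport p) (hg : Continuous g) :
    Integrable (fun x => g x * p x) μ := by
  have h : IntegrableOn (fun x => g x * p x) (tsupport p) μ :=
    hp.integrableOn.continuousOn_mul hg.continuousOn hs
  refine (integrableOn_iff_integrable_of_support_subset ?_).1 h
  intro x hx
  exact subset_tsupport p (right_ne_zero_of_mul hx)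

theorem hasDerivAt_integral_mul_of_hasCompactSupport_s14 {E : Type*} [TopologicalSpace E]
    [T2Space E] [MeasurableSpace E] [OpensMeasurableSpace E] {μ : Measure E} {p : E → ℝ}
    (hp : Integrable p μ) (hs : HasCompactSupport p) {G G' : ℝ → E → ℝ}
    (hG : ∀ t, Continuous (G t)) (hG' : Continuous (Function.uncurry G'))
    (hd : ∀ t x, HasDerivAt (fun s => G s x) (G' t x) t) (t₀ : ℝ) :
    HasDerivAt (fun t => ∫ x, G t x * p x ∂μ) (∫ x, G' t₀ x * p x ∂μ) t₀ := by
  obtain ⟨C, hC⟩ := ((isCompact_closedBall t₀ 1).prod hs).exists_bound_of_continuousOn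
    hG'.continuousOn
  have hG'c : Continuous (G' t₀) := hG'.comp (by fun_prop : Continuous fun x : E => (t₀, x))
  refine (hasDerivAt_integral_of_dominated_loc_of_deriv_le (bound := fun x => C * ‖p x‖)
    (F' := fun t x => G' t x * p x) (Metric.ball_mem_nhds t₀ one_pos) ?_ ?_ ?_ ?_ ?_ ?_).2
  · exact Filter.Eventually.of_forall fun t =>
      (integrable_continuous_mul_of_hasCompactSupport_s14 hp hs (hG t)).aestronglyMeasurable
  · exact integrable_continuous_mul_of_hasCompactSupport_s14 hp hs (hG t₀)
  · exact (integrable_continuous_mul_of_hasCompactSupport_s14 hp hs hG'c).aestronglyMeasurable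
  · refine Filter.Eventually.of_forall fun x t ht => ?_
    by_cases hx : p x = 0
    · simp [hx]
    · rw [norm_mul]
      exact mul_le_mul_of_nonneg_right
        (hC (t, x) ⟨Metric.ball_subset_closedBall ht, subset_tsupport p hx⟩) (norm_nonneg _)
  · exact hp.norm.const_mul C
  · exact Filter.Eventually.of_forall fun x t _ => (hd t x).mul_const (p x)

theorem hasDerivAt_gaussian_line {ι : Type*} [Fintype ι] (c σ : ℝ) (u v : ι → ℝ) (t : ℝ) :
    HasDerivAt (fun s : ℝ => c * Real.exp (-(∑ i, (u i + s * v i) ^ 2) / (2 * σ ^ 2)))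
      (-(∑ i, v i * (u i + t * v i)) / σ ^ 2 *
        (c * Real.exp (-(∑ i, (u i + t * v i) ^ 2) / (2 * σ ^ 2)))) t := by
  have h : ∀ i ∈ Finset.univ, HasDerivAt (fun s : ℝ => (u i + s * v i) ^ 2)
      (2 * (v i * (u i + t * v i))) t := fun i _ => by
    have := (((hasDerivAt_id t).mul_const (v i)).const_add (u i)).pow 2
    refine this.congr_deriv ?_
    simp
    ring
  refine ((((HasDerivAt.fun_sum h).neg.div_const (2 * σ ^ 2)).exp).const_mul c).congr_deriv ?_
  rw [← Finset.mul_sum, ← mul_neg, mul_div_mul_left _ _ (two_ne_zero)]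
  simp only [Pi.neg_apply]
  ring

/-- **Second directional posterior moment via directional derivative.** For a fixed `v` and
every `y`, the directional derivative `D_v μ₁^v(y) = d/dt μ₁^v(y + t v)|_{t=0}` exists and
`μ₂^v(y) = σ² D_v μ₁^v(y)`, where `μ₁^v(y) = ⟨v, μ₁(y)⟩`. -/
theorem second_directional_moment
    (d : ℕ) (hd : 1 ≤ d)
    (σ : ℝ) (hσ : 0 < σ)
    (p : (Fin d → ℝ) → ℝ) (hp_meas : Measurable p) (hp_nonneg : ∀ x, 0 ≤ p x)
    (hp_bdd : ∃ C, ∀ x, p x ≤ C) (hp_supp : HasCompactSupport p)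
    (hp_int : ∫ x, p x = 1)
    (φ : (Fin d → ℝ) → ℝ)
    (hφ : ∀ u, φ u = (2 * π * σ ^ 2) ^ (-(d : ℝ) / 2) *
      Real.exp (-(∑ i, u i ^ 2) / (2 * σ ^ 2)))
    (pY : (Fin d → ℝ) → ℝ) (hpY : ∀ y, pY y = ∫ x, φ (y - x) * p x)
    (hpY_pos : ∀ y, 0 < pY y)
    (μ₁ : (Fin d → ℝ) → Fin d → ℝ)
    (hμ₁ : ∀ y i, μ₁ y i = (∫ x, x i * φ (y - x) * p x) / pY y)
    (v : Fin d → ℝ)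
    (μ₁v : (Fin d → ℝ) → ℝ)
    (hμ₁v : ∀ y, μ₁v y = ∑ i, v i * μ₁ y i)
    (μv : ℕ → (Fin d → ℝ) → ℝ)
    (hμv : ∀ k : ℕ, 2 ≤ k → ∀ y : Fin d → ℝ,
      μv k y = (∫ x, (∑ i, v i * (x i - μ₁ y i)) ^ k * φ (y - x) * p x) / pY y)
    (y : Fin d → ℝ) :
    DifferentiableAt ℝ (fun t : ℝ => μ₁v (y + t • v)) 0 ∧
    μv 2 y = σ ^ 2 * deriv (fun t : ℝ => μ₁v (y + t • v)) 0 := by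
  have hpi : Integrable p := by
    by_contra h
    rw [integral_undef h] at hp_int
    exact zero_ne_one hp_int
  have hφc : Continuous φ := by
    rw [funext hφ]
    fun_prop
  set L : (Fin d → ℝ) → ℝ := fun x => ∑ i, v i * x i with hL
  have hLc : Continuous L := by fun_prop
  have hint : ∀ (h : (Fin d → ℝ) → ℝ) (z : Fin d → ℝ), Continuous h →
      Integrable (fun x => h x * φ (z - x) * p x) := fun h z hh =>
    integrable_continuous_mul_of_hasCompactSupport_s14 hpi hp_supp (by fun_prop)
  have hderiv : ∀ h : (Fin d → ℝ) → ℝ, Continuous h →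
      HasDerivAt (fun t : ℝ => ∫ x, h x * φ (y + t • v - x) * p x)
        (∫ x, h x * ((L x - L y) / σ ^ 2) * φ (y - x) * p x) 0 := by
    intro h hh
    have hline : ∀ (t : ℝ) (x : Fin d → ℝ), HasDerivAt (fun s : ℝ => h x * φ (y + s • v - x))
        (h x * (-(∑ i, v i * (y i - x i + t * v i)) / σ ^ 2 * φ (y + t • v - x))) t := by
      intro t x
      have hφ_line : ∀ s : ℝ, φ (y + s • v - x) = (2 * π * σ ^ 2) ^ (-(d : ℝ) / 2) *
          Real.exp (-(∑ i, ((y - x) i + s * v i) ^ 2) / (2 * σ ^ 2)) := fun s => by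
        rw [hφ]
        simp only [Pi.sub_apply, Pi.add_apply, Pi.smul_apply, smul_eq_mul, sub_add_eq_add_sub]
      simp only [hφ_line]
      exact (hasDerivAt_gaussian_line _ σ (y - x) v t).const_mul (h x)
    have hσ2 : σ ^ 2 ≠ 0 := by positivity
    refine (hasDerivAt_integral_mul_of_hasCompactSupport_s14 hpi hp_supp
      (G := fun t x => h x * φ (y + t • v - x)) (fun t => by fun_prop) ?_ hline 0).congr_deriv ?_
    · simp only [Function.uncurry_def]
      fun_prop
    · refine integral_congr_ae (Filter.Eventually.of_forall fun x => ?_)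
      simp only [hL, zero_mul, add_zero, zero_smul, mul_sub, Finset.sum_sub_distrib]
      ring
  set A : ℕ → ℝ := fun k => ∫ x, L x ^ k * φ (y - x) * p x with hA
  have hintA : ∀ k, Integrable (fun x => L x ^ k * φ (y - x) * p x) := fun k =>
    hint (fun x => L x ^ k) y (hLc.pow k)
  have hpY_eq : ∀ z, pY z = ∫ x, 1 * φ (z - x) * p x := fun z => by
    simp only [hpY, one_mul]
  have hμ₁v_eq : ∀ z, μ₁v z = (∫ x, L x * φ (z - x) * p x) / pY z := by
    intro z
    simp only [hμ₁v, hμ₁, ← mul_div_assoc, ← Finset.sum_div, ← integral_const_mul]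
    rw [← integral_finsetSum]
    · congr 2 with x
      simp only [hL, Finset.sum_mul, mul_assoc]
    · exact fun i _ => (hint (fun x => x i) z (by fun_prop)).const_mul (v i)
  have hA0 : pY y = A 0 := by simp [hA, hpY]
  have hA1 : ∫ x, L x * φ (y - x) * p x = A 1 := by simp [hA]
  have hA0_pos : 0 < A 0 := hA0 ▸ hpY_pos y
  have hA0_ne := hA0_pos.ne'
  have hN' : ∫ x, L x * ((L x - L y) / σ ^ 2) * φ (y - x) * p x =
      (A 2 - L y * A 1) / σ ^ 2 := by
    rw [hA, ← integral_const_mul, ← integral_sub (hintA 2) ((hintA 1).const_mul _),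
      ← integral_div]
    congr 1 with x
    ring
  have hD' : ∫ x, 1 * ((L x - L y) / σ ^ 2) * φ (y - x) * p x =
      (A 1 - L y * A 0) / σ ^ 2 := by
    rw [hA, ← integral_const_mul, ← integral_sub (hintA 1) ((hintA 0).const_mul _),
      ← integral_div]
    congr 1 with x
    ring
  have hN := hderiv L hLc
  have hD := hderiv (fun _ => 1) continuous_const
  simp only [← hpY_eq] at hD
  have hquot := hN.fun_div hD (by simpa using (hpY_pos y).ne')
  simp only [← hμ₁v_eq, hN', hD', zero_smul, add_zero, hA0, hA1] at hquot
  refine ⟨hquot.differentiableAt, ?_⟩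
  rw [hquot.deriv, hμv 2 le_rfl, hA0]
  have hm : ∑ i, v i * μ₁ y i = A 1 / A 0 := by
    rw [← hμ₁v, hμ₁v_eq, hA0, hA1]
  have hvar : ∫ x, (∑ i, v i * (x i - μ₁ y i)) ^ 2 * φ (y - x) * p x =
      A 2 - 2 * (A 1 / A 0) * A 1 + (A 1 / A 0) ^ 2 * A 0 := by
    simp only [mul_sub, Finset.sum_sub_distrib, hm]
    generalize A 1 / A 0 = m
    rw [hA, ← integral_const_mul, ← integral_const_mul,
      ← integral_sub (hintA 2) ((hintA 1).const_mul _),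
      ← integral_add ((hintA 2).sub' ((hintA 1).const_mul _)) ((hintA 0).const_mul _)]
    congr 1 with x
    simp only [hL]
    ring
  rw [hvar]
  field_simp
  ring
end

section
/- Let v ∈ ℝ^d be a fixed vector. For every integer k ≥ 3 and every y ∈ ℝ^d, the directional derivative D_v μ_k^v(y) exists and the directional posterior central moments satisfy the recursion μ_{k+1}^v(y) = σ² · D_v μ_k^v(y) + k · μ_{k−1}^v(y) · μ₂^v(y). -/
open MeasureTheory Real

namespace ProbabilityTheory

variable {Ω : Type*} [MeasurableSpace Ω] {X : Ω → ℝ} {ν : Measure Ω}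

/-- The unnormalized mixed moment `∫ X ^ n (X - a) ^ k exp (t X) dν` of an exponential tilt. -/
noncomputable def tiltedMoment (X : Ω → ℝ) (ν : Measure Ω) (n k : ℕ) (a t : ℝ) : ℝ :=
  ∫ ω, X ω ^ n * (X ω - a) ^ k * exp (t * X ω) ∂ν

lemma integrable_pow_mul_sub_pow_mul_exp (hX : integrableExpSet X ν = Set.univ)
    (n k : ℕ) (a t : ℝ) :
    Integrable (fun ω ↦ X ω ^ n * (X ω - a) ^ k * exp (t * X ω)) ν := by
  induction k generalizing n with
  | zero =>
    simpa using integrable_pow_mul_exp_of_mem_interior_integrableExpSet (v := t) (by simp [hX]) n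
  | succ k ih =>
    convert! (ih (n + 1)).sub ((ih n).const_mul a) using 1
    ext ω
    simp only [Pi.sub_apply]
    ring

lemma tiltedMoment_succ (hX : integrableExpSet X ν = Set.univ) (n k : ℕ) (a t : ℝ) :
    tiltedMoment X ν n (k + 1) a t =
      tiltedMoment X ν (n + 1) k a t - a * tiltedMoment X ν n k a t := by
  unfold tiltedMoment
  rw [← integral_const_mul, ← integral_sub (integrable_pow_mul_sub_pow_mul_exp hX _ _ _ _)
    ((integrable_pow_mul_sub_pow_mul_exp hX _ _ _ _).const_mul a)]
  congr with ω
  ring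

lemma tiltedMoment_zero_right (n : ℕ) (a b t : ℝ) :
    tiltedMoment X ν n 0 a t = tiltedMoment X ν n 0 b t := by
  simp [tiltedMoment]

lemma hasDerivAt_tiltedMoment (hX : integrableExpSet X ν = Set.univ) {a : ℝ → ℝ} {a' t : ℝ}
    (ha : HasDerivAt a a' t) (n k : ℕ) :
    HasDerivAt (fun s ↦ tiltedMoment X ν n k (a s) s)
      (tiltedMoment X ν (n + 1) k (a t) t - k * a' * tiltedMoment X ν n (k - 1) (a t) t) t := by
  induction k generalizing n with
  | zero =>
    simpa [tiltedMoment] using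
      hasDerivAt_integral_pow_mul_exp_real (X := X) (μ := ν) (t := t) (by simp [hX]) n
  | succ k ih =>
    simp_rw [tiltedMoment_succ hX n k]
    convert! (ih (n + 1)).sub (ha.mul (ih n)) using 1
    rw [tiltedMoment_succ hX, Nat.add_sub_cancel]
    cases k with
    | zero => simp; ring
    | succ j =>
      simp only [Nat.add_sub_cancel, tiltedMoment_succ hX n j]
      push_cast
      ring

/-- The mean of `X` under the exponential tilt of `ν` by `t X`. -/
noncomputable def tiltedMean (X : Ω → ℝ) (ν : Measure Ω) (t : ℝ) : ℝ :=
  tiltedMoment X ν 1 0 0 t / tiltedMoment X ν 0 0 0 t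

/-- The `k`-th central moment of `X` under the exponential tilt of `ν` by `t X`. -/
noncomputable def tiltedCentralMoment (X : Ω → ℝ) (ν : Measure Ω) (k : ℕ) (t : ℝ) : ℝ :=
  tiltedMoment X ν 0 k (tiltedMean X ν t) t / tiltedMoment X ν 0 0 0 t

lemma hasDerivAt_tiltedMean (hX : integrableExpSet X ν = Set.univ) {t : ℝ}
    (ht : tiltedMoment X ν 0 0 0 t ≠ 0) :
    HasDerivAt (tiltedMean X ν) (tiltedCentralMoment X ν 2 t) t := by
  have h (n : ℕ) := hasDerivAt_tiltedMoment hX (hasDerivAt_const t (0 : ℝ)) n 0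
  convert! (h 1).div (h 0) ht using 1
  simp only [tiltedCentralMoment, tiltedMoment_succ hX]
  simp only [tiltedMoment_zero_right _ (tiltedMean X ν t) 0]
  simp only [tiltedMean]
  field_simp
  simp
  ring

lemma hasDerivAt_tiltedCentralMoment (hX : integrableExpSet X ν = Set.univ) {t : ℝ}
    (ht : tiltedMoment X ν 0 0 0 t ≠ 0) (k : ℕ) :
    HasDerivAt (tiltedCentralMoment X ν k)
      (tiltedCentralMoment X ν (k + 1) t
        - k * tiltedCentralMoment X ν (k - 1) t * tiltedCentralMoment X ν 2 t) t := by
  have h0 := hasDerivAt_tiltedMoment hX (hasDerivAt_const t (0 : ℝ)) 0 0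
  convert! (hasDerivAt_tiltedMoment hX (hasDerivAt_tiltedMean hX ht) 0 k).div h0 ht using 1
  generalize tiltedCentralMoment X ν 2 t = c
  simp only [tiltedCentralMoment, tiltedMoment_succ hX 0 k]
  have hm : tiltedMoment X ν 1 0 0 t = tiltedMean X ν t * tiltedMoment X ν 0 0 0 t := by
    rw [tiltedMean, div_mul_cancel₀ _ ht]
  simp only [zero_add, hm]
  field_simp
  simp
  ring

end ProbabilityTheory

/-- An integrable function supported in the support of a compactly supported function stays
integrable after multiplication by a continuous function. -/
lemma HasCompactSupport.integrable_continuous_mul {E : Type*} [TopologicalSpace E]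
    [MeasurableSpace E] [OpensMeasurableSpace E] {μ : Measure E} {p f q : E → ℝ}
    (hp : HasCompactSupport p) (hf : Continuous f) (hq : Integrable q μ)
    (hqp : ∀ x, p x = 0 → q x = 0) : Integrable (fun x ↦ f x * q x) μ := by
  obtain ⟨B, hB⟩ := hp.isCompact.exists_bound_of_continuousOn hf.continuousOn
  refine (hq.norm.const_mul B).mono' (hf.aestronglyMeasurable.mul hq.aestronglyMeasurable)
    (.of_forall fun x ↦ ?_)
  by_cases hx : p x = 0
  · simp [hqp x hx]
  · rw [norm_mul]
    gcongr
    exact hB x (subset_tsupport p hx)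

/-- Weighting by a nonnegative integrable function supported in the support of a compactly
supported function makes every continuous function have exponential moments of all orders. -/
lemma HasCompactSupport.integrableExpSet_withDensity {E : Type*} [TopologicalSpace E]
    [MeasurableSpace E] [BorelSpace E] {μ : Measure E} {p f q : E → ℝ}
    (hp : HasCompactSupport p) (hf : Continuous f) (hq : Integrable q μ) (hqm : Measurable q)
    (hq0 : ∀ x, 0 ≤ q x) (hqp : ∀ x, p x = 0 → q x = 0) :
    ProbabilityTheory.integrableExpSet f (μ.withDensity fun x ↦ ENNReal.ofReal (q x))
      = Set.univ := by
  ext t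
  simp only [ProbabilityTheory.integrableExpSet, Set.mem_ofPred_eq, Set.mem_univ, iff_true]
  rw [integrable_withDensity_iff (by fun_prop) (by simp)]
  simp only [ENNReal.toReal_ofReal (hq0 _)]
  exact hp.integrable_continuous_mul (by fun_prop) hq hqp

/-- Moving the centre of a Gaussian by `t v` tilts it exponentially. -/
lemma exp_neg_sum_sq_add_smul {ι : Type*} [Fintype ι] (u x v : ι → ℝ) (σ t : ℝ) (hσ : σ ≠ 0) :
    exp (-(∑ i, (u + t • v - x) i ^ 2) / (2 * σ ^ 2)) =
      exp (-(2 * t * (∑ i, v i * u i) + t ^ 2 * ∑ i, v i ^ 2) / (2 * σ ^ 2)) *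
        (exp (t / σ ^ 2 * ∑ i, v i * x i) * exp (-(∑ i, (u - x) i ^ 2) / (2 * σ ^ 2))) := by
  have h : ∑ i, (u + t • v - x) i ^ 2 = ∑ i, (u - x) i ^ 2 + 2 * t * (∑ i, v i * u i)
      - 2 * t * (∑ i, v i * x i) + t ^ 2 * ∑ i, v i ^ 2 := by
    simp only [Finset.mul_sum, ← Finset.sum_add_distrib, ← Finset.sum_sub_distrib]
    refine Finset.sum_congr rfl fun i _ ↦ ?_
    simp only [Pi.sub_apply, Pi.add_apply, Pi.smul_apply, smul_eq_mul]
    ring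
  rw [← exp_add, ← exp_add, h]
  congr 1
  field_simp
  ring

/-- **Recursion for directional posterior central moments.** For a fixed `v`, every `k ≥ 3`
and every `y`, the directional derivative `D_v μ_k^v(y)` exists and
`μ_{k+1}^v(y) = σ² D_v μ_k^v(y) + k μ_{k-1}^v(y) μ₂^v(y)`. -/
theorem directional_moment_recursion
    (d : ℕ) (hd : 1 ≤ d)
    (σ : ℝ) (hσ : 0 < σ)
    (p : (Fin d → ℝ) → ℝ) (hp_meas : Measurable p) (hp_nonneg : ∀ x, 0 ≤ p x)
    (hp_bdd : ∃ C, ∀ x, p x ≤ C) (hp_supp : HasCompactSupport p)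
    (hp_int : ∫ x, p x = 1)
    (φ : (Fin d → ℝ) → ℝ)
    (hφ : ∀ u, φ u = (2 * π * σ ^ 2) ^ (-(d : ℝ) / 2) *
      Real.exp (-(∑ i, u i ^ 2) / (2 * σ ^ 2)))
    (pY : (Fin d → ℝ) → ℝ) (hpY : ∀ y, pY y = ∫ x, φ (y - x) * p x)
    (hpY_pos : ∀ y, 0 < pY y)
    (μ₁ : (Fin d → ℝ) → Fin d → ℝ)
    (hμ₁ : ∀ y i, μ₁ y i = (∫ x, x i * φ (y - x) * p x) / pY y)
    (v : Fin d → ℝ)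
    (μv : ℕ → (Fin d → ℝ) → ℝ)
    (hμv : ∀ k : ℕ, 2 ≤ k → ∀ y : Fin d → ℝ,
      μv k y = (∫ x, (∑ i, v i * (x i - μ₁ y i)) ^ k * φ (y - x) * p x) / pY y) :
    ∀ k : ℕ, 3 ≤ k → ∀ y : Fin d → ℝ,
      DifferentiableAt ℝ (fun t : ℝ => μv k (y + t • v)) 0 ∧
      μv (k + 1) y =
        σ ^ 2 * deriv (fun t : ℝ => μv k (y + t • v)) 0 +
        (k : ℝ) * μv (k - 1) y * μv 2 y := by
  intro k hk y
  have hφm : Measurable φ := by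
    rw [funext hφ]
    fun_prop
  have hφ0 (u) : 0 ≤ φ u := by
    rw [hφ]
    positivity
  have hint (z) : Integrable (fun x ↦ φ (z - x) * p x) :=
    .of_integral_ne_zero (by rw [← hpY]; exact (hpY_pos z).ne')
  set w : (Fin d → ℝ) → ℝ := fun x ↦ φ (y - x) * p x with hw
  have hwm : Measurable w := by fun_prop
  have hw0 (x) : 0 ≤ w x := mul_nonneg (hφ0 _) (hp_nonneg x)
  set ν : Measure (Fin d → ℝ) := volume.withDensity fun x ↦ ENNReal.ofReal (w x) with hν
  have hν_int (f : (Fin d → ℝ) → ℝ) : ∫ x, f x ∂ν = ∫ x, w x * f x := by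
    rw [hν, integral_withDensity_eq_integral_toReal_smul (by fun_prop) (by simp)]
    simp only [ENNReal.toReal_ofReal (hw0 _), smul_eq_mul]
  set X : (Fin d → ℝ) → ℝ := fun x ↦ ∑ i, v i * x i with hX
  have hXν : ProbabilityTheory.integrableExpSet X ν = Set.univ :=
    hp_supp.integrableExpSet_withDensity (by fun_prop) (hint y) hwm hw0
      fun x hx ↦ by simp [hw, hx]
  set g : ℝ → ℝ := fun t ↦
    exp (-(2 * t * (∑ i, v i * y i) + t ^ 2 * ∑ i, v i ^ 2) / (2 * σ ^ 2)) with hg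
  have hshift (t : ℝ) (x) : φ (y + t • v - x) = g t * (exp (t / σ ^ 2 * X x) * φ (y - x)) := by
    rw [hφ, hφ, exp_neg_sum_sq_add_smul y x v σ t hσ.ne']
    ring
  have hmoment (n j : ℕ) (a t : ℝ) :
      ∫ x, X x ^ n * (X x - a) ^ j * φ (y + t • v - x) * p x =
        g t * ProbabilityTheory.tiltedMoment X ν n j a (t / σ ^ 2) := by
    rw [ProbabilityTheory.tiltedMoment, hν_int, ← integral_const_mul]
    congr with x
    rw [hshift, hw]
    ring
  have hpY_eq (t : ℝ) :
      pY (y + t • v) = g t * ProbabilityTheory.tiltedMoment X ν 0 0 0 (t / σ ^ 2) := by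
    rw [hpY, ← hmoment]
    simp
  have hg0 (t : ℝ) : g t ≠ 0 := (exp_pos _).ne'
  have hmean (t : ℝ) :
      ∑ i, v i * μ₁ (y + t • v) i = ProbabilityTheory.tiltedMean X ν (t / σ ^ 2) := by
    have hsum : ∑ i, v i * ∫ x, x i * φ (y + t • v - x) * p x =
        g t * ProbabilityTheory.tiltedMoment X ν 1 0 0 (t / σ ^ 2) := by
      rw [← hmoment]
      simp only [← integral_const_mul]
      rw [← integral_finsetSum]
      · congr with x
        simp only [hX, pow_one, pow_zero, mul_one, Finset.sum_mul, mul_assoc]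
      · intro i _
        refine Integrable.const_mul ?_ _
        simp only [mul_assoc]
        exact hp_supp.integrable_continuous_mul (continuous_apply i) (hint _)
          fun x hx ↦ by simp [hx]
    simp only [hμ₁, ← mul_div_assoc, ← Finset.sum_div]
    rw [hsum, hpY_eq, mul_div_mul_left _ _ (hg0 t), ProbabilityTheory.tiltedMean]
  have hcentral (j : ℕ) (hj : 2 ≤ j) (t : ℝ) :
      μv j (y + t • v) = ProbabilityTheory.tiltedCentralMoment X ν j (t / σ ^ 2) := by
    have hm := hmoment 0 j (ProbabilityTheory.tiltedMean X ν (t / σ ^ 2)) t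
    rw [ProbabilityTheory.tiltedCentralMoment, ← mul_div_mul_left _ _ (hg0 t), ← hpY_eq, ← hm,
      ← hmean, hμv j hj]
    simp only [hX, mul_sub, Finset.sum_sub_distrib, pow_zero, one_mul]
  have hcentral_zero (j : ℕ) (hj : 2 ≤ j) :
      μv j y = ProbabilityTheory.tiltedCentralMoment X ν j 0 := by
    simpa using hcentral j hj 0
  have hM0 : ProbabilityTheory.tiltedMoment X ν 0 0 0 (0 / σ ^ 2) ≠ 0 := by
    have h := (hpY_pos (y + (0 : ℝ) • v)).ne'
    rw [hpY_eq] at h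
    exact right_ne_zero_of_mul h
  have hderiv := (ProbabilityTheory.hasDerivAt_tiltedCentralMoment hXν hM0 k).comp (0 : ℝ)
    ((hasDerivAt_id (0 : ℝ)).div_const (σ ^ 2))
  have hfun : (fun t : ℝ ↦ μv k (y + t • v)) =
      ProbabilityTheory.tiltedCentralMoment X ν k ∘ fun t ↦ id t / σ ^ 2 :=
    funext fun t ↦ hcentral k (by omega) t
  rw [hfun]
  refine ⟨hderiv.differentiableAt, ?_⟩
  rw [hderiv.deriv, hcentral_zero _ (by omega), hcentral_zero _ (by omega),
    hcentral_zero 2 le_rfl, zero_div]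
  field_simp
  ring
end
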